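/- arXiv:2603.21171 — 6 statements merged into one kernel-verified Lean document; each statement's English description precedes it below -/
import Mathlib

section
/- Let N ≥ 3, let Ω ⊆ B be an open set, let λ ∈ ℝ, and let u : Ω → ℝ be twice continuously differentiable. Set v(x) = ϱ(x)^{(N−2)/2} u(x). Then u satisfies the transformed hyperbolic Brezis–Nirenberg equation ϱ(x)^{−N} div(ϱ^{N−2} ∇u)(x) + λ u(x) + |u(x)|^{2*−2} u(x) = 0 at every point x ∈ Ω if and only if v satisfies the weighted Euclidean equation −Δv(x) = (λ − λ₀) ϱ(x)² v(x) + |v(x)|^{2*−2} v(x) at every point x ∈ Ω. -/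
open MeasureTheory Real RealInnerProductSpace

noncomputable section

/-- Euclidean space `ℝ^N`. -/
abbrev Euc (N : ℕ) := EuclideanSpace ℝ (Fin N)

/-- Conformal factor of the Poincaré ball model, `ϱ(x) = 2/(1 − |x|²)`. -/
def rho {N : ℕ} (x : Euc N) : ℝ := 2 / (1 - ‖x‖ ^ 2)

/-- The spectral shift `λ₀ = N(N−2)/4`. -/
def lam0 (N : ℕ) : ℝ := (N : ℝ) * ((N : ℝ) - 2) / 4

/-- The critical Sobolev exponent `2* = 2N/(N−2)`. -/
def twoStar (N : ℕ) : ℝ := 2 * (N : ℝ) / ((N : ℝ) - 2)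

/-- Euclidean divergence of a vector field: trace of the derivative. -/
def ediv {N : ℕ} (F : Euc N → Euc N) (x : Euc N) : ℝ :=
  ∑ i, ⟪fderiv ℝ F x (EuclideanSpace.single i 1), EuclideanSpace.single i 1⟫

/-- Euclidean Laplacian of a real function: trace of the second derivative. -/
def lap {N : ℕ} (f : Euc N → ℝ) (x : Euc N) : ℝ :=
  ∑ i, fderiv ℝ (fun y => fderiv ℝ f y (EuclideanSpace.single i 1)) x
    (EuclideanSpace.single i 1)

theorem rho_pos {N : ℕ} {x : Euc N} (hx : ‖x‖ < 1) : 0 < rho x := by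
  have h : ‖x‖ ^ 2 < 1 := by nlinarith [norm_nonneg x]
  exact div_pos two_pos (by linarith)

theorem hasFDerivAt_rho {N : ℕ} {x : Euc N} (hx : ‖x‖ < 1) :
    HasFDerivAt (rho (N := N)) (rho x ^ 2 • innerSL ℝ x) x := by
  have h : 1 - ‖x‖ ^ 2 ≠ 0 := by nlinarith [norm_nonneg x]
  have h1 : HasFDerivAt (fun y : Euc N => 1 - ‖y‖ ^ 2) (-(2 • innerSL ℝ x)) x :=
    ((hasStrictFDerivAt_norm_sq x).hasFDerivAt).const_sub 1
  have h2 := (hasDerivAt_inv h).comp_hasFDerivAt x h1 |>.const_mul 2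
  have h3 : rho (N := N) = fun y => 2 * (Inv.inv ∘ fun y : Euc N => 1 - ‖y‖ ^ 2) y := by
    funext y
    simp [rho, div_eq_mul_inv]
  rw [h3]
  refine h2.congr_fderiv ?_
  ext e
  simp
  field_simp

theorem hasFDerivAt_rho_rpow {N : ℕ} (p : ℝ) {x : Euc N} (hx : ‖x‖ < 1) :
    HasFDerivAt (fun y : Euc N => rho y ^ p) ((p * rho x ^ (p + 1)) • innerSL ℝ x) x := by
  have h := (hasFDerivAt_rho hx).rpow_const (p := p) (Or.inl (rho_pos hx).ne')
  refine h.congr_fderiv ?_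
  rw [smul_smul]
  congr 1
  rw [mul_assoc, ← rpow_natCast, ← rpow_add (rho_pos hx)]
  congr 2
  push_cast
  ring

theorem eventually_norm_lt_one {N : ℕ} {x : Euc N} (hx : ‖x‖ < 1) :
    ∀ᶠ y in nhds x, ‖y‖ < 1 :=
  continuous_norm.continuousAt.eventually_lt continuousAt_const hx

theorem contDiffAt_rho_rpow {N : ℕ} (p : ℝ) {n : WithTop ℕ∞} {x : Euc N} (hx : ‖x‖ < 1) :
    ContDiffAt ℝ n (fun y : Euc N => rho y ^ p) x := by
  have h : 1 - ‖x‖ ^ 2 ≠ 0 := by nlinarith [norm_nonneg x]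
  have h1 : ContDiffAt ℝ n (rho (N := N)) x :=
    contDiffAt_const.div (contDiffAt_const.sub (contDiff_norm_sq ℝ).contDiffAt) h
  exact h1.rpow_const_of_ne (rho_pos hx).ne'

theorem lap_rho_rpow {N : ℕ} (p : ℝ) {x : Euc N} (hx : ‖x‖ < 1) :
    lap (fun y : Euc N => rho y ^ p) x =
      p * (p + 1) * rho x ^ (p + 2) * ‖x‖ ^ 2 + N * (p * rho x ^ (p + 1)) := by
  have key : ∀ i, fderiv ℝ (fun y => fderiv ℝ (fun y : Euc N => rho y ^ p) y
      (EuclideanSpace.single i 1)) x (EuclideanSpace.single i 1) =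
      p * (p + 1) * rho x ^ (p + 2) * x i ^ 2 + p * rho x ^ (p + 1) := by
    intro i
    have h1 : (fun y => fderiv ℝ (fun y : Euc N => rho y ^ p) y (EuclideanSpace.single i 1))
        =ᶠ[nhds x] fun y => p * rho y ^ (p + 1) * EuclideanSpace.proj (𝕜 := ℝ) i y := by
      filter_upwards [eventually_norm_lt_one hx] with y hy
      rw [(hasFDerivAt_rho_rpow p hy).fderiv]
      simp [EuclideanSpace.inner_single_right]
    have h2 := ((hasFDerivAt_rho_rpow (p + 1) hx).const_mul p).fun_mul
      (EuclideanSpace.proj (𝕜 := ℝ) i : Euc N →L[ℝ] ℝ).hasFDerivAt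
    rw [h1.fderiv_eq, HasFDerivAt.fderiv h2]
    simp [EuclideanSpace.inner_single_right, show p + 1 + 1 = p + 2 by ring]
    ring
  simp only [lap, key, Finset.sum_add_distrib, ← Finset.mul_sum, EuclideanSpace.real_norm_sq_eq]
  simp
  ring

theorem ContDiffAt.differentiableAt_fderiv {E F : Type*} [NormedAddCommGroup E] [NormedSpace ℝ E]
    [NormedAddCommGroup F] [NormedSpace ℝ F] {f : E → F} {x : E} (hf : ContDiffAt ℝ 2 f x) :
    DifferentiableAt ℝ (fderiv ℝ f) x :=
  (hf.fderiv_right (m := 1) (by norm_num)).differentiableAt (by norm_num)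

theorem ContDiffAt.eventually_differentiableAt {E F : Type*} [NormedAddCommGroup E]
    [NormedSpace ℝ E] [NormedAddCommGroup F] [NormedSpace ℝ F] {f : E → F} {x : E}
    (hf : ContDiffAt ℝ 2 f x) : ∀ᶠ y in nhds x, DifferentiableAt ℝ f y := by
  filter_upwards [hf.eventually (by simp)] with y hy
  exact hy.differentiableAt (by norm_num)

theorem ediv_sq_smul_gradient {N : ℕ} {w u : Euc N → ℝ} {x : Euc N}
    (hw : ContDiffAt ℝ 2 w x) (hu : ContDiffAt ℝ 2 u x) :
    ediv (fun y => w y ^ 2 • gradient u y) x =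
      w x * lap (fun y => w y * u y) x - w x * u x * lap w x := by
  have hwx : DifferentiableAt ℝ w x := hw.differentiableAt (by norm_num)
  have hux : DifferentiableAt ℝ u x := hu.differentiableAt (by norm_num)
  have hgrad : DifferentiableAt ℝ (gradient u) x :=
    ((InnerProductSpace.toDual ℝ (Euc N)).symm.toContinuousLinearEquiv.differentiableAt).comp x
      hu.differentiableAt_fderiv
  have hF : DifferentiableAt ℝ (fun y => w y ^ 2 • gradient u y) x := (hwx.pow 2).smul hgrad
  simp only [ediv, lap, Finset.mul_sum, ← Finset.sum_sub_distrib]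
  refine Finset.sum_congr rfl fun i _ => ?_
  set e : Euc N := EuclideanSpace.single i 1
  have hwe : DifferentiableAt ℝ (fun y => fderiv ℝ w y e) x :=
    hw.differentiableAt_fderiv.clm_apply (differentiableAt_const e)
  have hue : DifferentiableAt ℝ (fun y => fderiv ℝ u y e) x :=
    hu.differentiableAt_fderiv.clm_apply (differentiableAt_const e)
  have hinner : ⟪fderiv ℝ (fun y => w y ^ 2 • gradient u y) x e, e⟫ =
      fderiv ℝ (fun y => w y ^ 2 * fderiv ℝ u y e) x e := by
    have h := fderiv_inner_apply ℝ hF (differentiableAt_const e) e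
    simp only [fderiv_fun_const, Pi.zero_apply, zero_apply, inner_zero_right,
      zero_add] at h
    rw [← h]
    congr 2
    funext y
    rw [real_inner_smul_left, gradient, InnerProductSpace.toDual_symm_apply]
  have hprod : (fun y => fderiv ℝ (fun y => w y * u y) y e) =ᶠ[nhds x]
      fun y => w y * fderiv ℝ u y e + u y * fderiv ℝ w y e := by
    filter_upwards [hw.eventually_differentiableAt, hu.eventually_differentiableAt] with y h1 h2
    rw [fderiv_fun_mul h1 h2]
    simp
  rw [hinner, hprod.fderiv_eq, fderiv_fun_add (hwx.fun_mul hue) (hux.fun_mul hwe), fderiv_fun_mul hwx hue,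
    fderiv_fun_mul hux hwe, fderiv_fun_mul (hwx.fun_pow 2) hue, fderiv_fun_pow 2 hwx]
  simp
  ring

theorem lap_rho_rpow_half {N : ℕ} {x : Euc N} (hx : ‖x‖ < 1) :
    lap (fun y : Euc N => rho y ^ (((N : ℝ) - 2) / 2)) x =
      lam0 N * rho x ^ 2 * rho x ^ (((N : ℝ) - 2) / 2) := by
  have hr := rho_pos hx
  have h : 1 - ‖x‖ ^ 2 ≠ 0 := by nlinarith [norm_nonneg x]
  have hrn : rho x * ‖x‖ ^ 2 = rho x - 2 := by
    rw [rho]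
    field_simp
    ring
  rw [lap_rho_rpow _ hx, rpow_add hr, rpow_add hr, rpow_one, rpow_two, lam0]
  linear_combination ((N : ℝ) - 2) / 2 * (((N : ℝ) - 2) / 2 + 1) *
    rho x ^ (((N : ℝ) - 2) / 2) * rho x * hrn

theorem ediv_rho_rpow_smul_gradient {N : ℕ} {u : Euc N → ℝ} {x : Euc N} (hx : ‖x‖ < 1)
    (hu : ContDiffAt ℝ 2 u x) :
    ediv (fun y => rho y ^ ((N : ℝ) - 2) • gradient u y) x =
      rho x ^ (((N : ℝ) - 2) / 2) *
        (lap (fun y => rho y ^ (((N : ℝ) - 2) / 2) * u y) x -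
          lam0 N * rho x ^ 2 * (rho x ^ (((N : ℝ) - 2) / 2) * u x)) := by
  have h : (fun y => rho y ^ ((N : ℝ) - 2) • gradient u y) =ᶠ[nhds x]
      fun y => (rho y ^ (((N : ℝ) - 2) / 2)) ^ 2 • gradient u y := by
    filter_upwards [eventually_norm_lt_one hx] with y hy
    rw [← rpow_natCast, ← rpow_mul (rho_pos hy).le]
    congr 2
    push_cast
    ring
  have h' := ediv_sq_smul_gradient (contDiffAt_rho_rpow (((N : ℝ) - 2) / 2) hx) hu
  rw [lap_rho_rpow_half hx] at h'
  rw [ediv, h.fderiv_eq]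
  exact h'.trans (by ring)

/-- Pointwise equivalence between the hyperbolic Brezis–Nirenberg equation
and the weighted Euclidean equation under the conformal change of variables
`v = ϱ^{(N−2)/2} u`. -/
theorem stmt_0 {N : ℕ} (hN : 3 ≤ N) (Ω : Set (Euc N)) (hΩ : IsOpen Ω)
    (hΩB : Ω ⊆ {x : Euc N | ‖x‖ < 1}) (lam : ℝ) (u : Euc N → ℝ)
    (hu : ContDiffOn ℝ 2 u Ω) (v : Euc N → ℝ)
    (hv : ∀ x, v x = rho x ^ (((N : ℝ) - 2) / 2) * u x) :
    (∀ x ∈ Ω,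
        rho x ^ (-(N : ℝ)) * ediv (fun y => rho y ^ ((N : ℝ) - 2) • gradient u y) x
          + lam * u x + |u x| ^ (twoStar N - 2) * u x = 0)
      ↔ (∀ x ∈ Ω,
        -lap v x = (lam - lam0 N) * rho x ^ 2 * v x
          + |v x| ^ (twoStar N - 2) * v x) := by
  obtain rfl : v = fun x => rho x ^ (((N : ℝ) - 2) / 2) * u x := funext hv
  refine forall₂_congr fun x hx => ?_
  have hx1 : ‖x‖ < 1 := hΩB hx
  have hr := rho_pos hx1
  have hN2 : (0 : ℝ) < (N : ℝ) - 2 := by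
    have : (3 : ℝ) ≤ N := by exact_mod_cast hN
    linarith
  rw [ediv_rho_rpow_smul_gradient hx1 (hu.contDiffAt (hΩ.mem_nhds hx))]
  have hneg : rho x ^ (-(N : ℝ)) *
      (rho x ^ (((N : ℝ) - 2) / 2) * (rho x ^ (((N : ℝ) - 2) / 2) * rho x ^ 2)) = 1 := by
    rw [← rpow_two, ← rpow_add hr, ← rpow_add hr, ← rpow_add hr, ← rpow_zero (rho x)]
    congr 1
    ring
  have hcrit : |rho x ^ (((N : ℝ) - 2) / 2) * u x| ^ (twoStar N - 2) =
      rho x ^ 2 * |u x| ^ (twoStar N - 2) := by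
    rw [abs_mul, abs_of_pos (rpow_pos_of_pos hr _),
      mul_rpow (rpow_pos_of_pos hr _).le (abs_nonneg _),
      ← rpow_mul hr.le, ← rpow_two]
    congr 2
    rw [twoStar]
    field_simp
    ring
  rw [hcrit]
  have hc : rho x ^ (((N : ℝ) - 2) / 2) * rho x ^ 2 ≠ 0 :=
    (mul_pos (rpow_pos_of_pos hr _) (pow_pos hr 2)).ne'
  set w := rho x ^ (((N : ℝ) - 2) / 2)
  set L := lap (fun y => rho y ^ (((N : ℝ) - 2) / 2) * u y) x
  rw [← mul_right_inj' hc, mul_zero]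
  constructor
  · intro h
    linear_combination -h + (L - lam0 N * rho x ^ 2 * (w * u x)) * hneg
  · intro h
    linear_combination -h + (L - lam0 N * rho x ^ 2 * (w * u x)) * hneg
end
end

section
/- Let N ≥ 3, let Ω ⊆ B be an open set, let λ ∈ ℝ, and let u : Ω → ℝ be twice continuously differentiable. Set v(x) = ϱ(x)^{(N−2)/2} u(x). Then u satisfies ϱ(x)^{−N} div(ϱ^{N−2} ∇u)(x) + λ u(x) = 0 at every point x ∈ Ω if and only if v satisfies −Δv(x) = (λ − λ₀) ϱ(x)² v(x) at every point x ∈ Ω. (This is the pointwise form of the correspondence between the Dirichlet eigenvalues λ_n of the hyperbolic Laplace–Beltrami operator and the eigenvalues μ_n = λ_n − λ₀ of the weighted Euclidean eigenvalue problem.) -/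
open MeasureTheory Real RealInnerProductSpace

noncomputable section

namespace Euc

variable {N : ℕ}

lemma rho_pos {x : Euc N} (hx : ‖x‖ < 1) : 0 < rho x := by
  have : ‖x‖ ^ 2 < 1 := by nlinarith [norm_nonneg x]
  exact div_pos two_pos (by linarith)

lemma eventually_norm_lt_one {x : Euc N} (hx : ‖x‖ < 1) : ∀ᶠ y in nhds x, ‖y‖ < 1 :=
  continuous_norm.continuousAt.eventually_lt_const hx

lemma hasFDerivAt_rho {x : Euc N} (hx : ‖x‖ < 1) :
    HasFDerivAt rho (rho x ^ 2 • innerSL ℝ x) x := by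
  have h1 : 0 < 1 - ‖x‖ ^ 2 := by nlinarith [norm_nonneg x]
  have h2 : HasFDerivAt (fun y : Euc N => 1 - ‖y‖ ^ 2) (-(2 • innerSL ℝ x)) x := by
    simpa using ((hasStrictFDerivAt_norm_sq x).hasFDerivAt.const_sub 1)
  have h3 := ((hasDerivAt_inv h1.ne').comp_hasFDerivAt x h2).const_mul (2 : ℝ)
  refine (h3.congr_fderiv ?_).congr_of_eventuallyEq (.of_forall fun y => ?_)
  · ext y
    simp [rho]
    field_simp
  · simp [rho, div_eq_mul_inv]

lemma hasFDerivAt_rho_rpow {x : Euc N} (hx : ‖x‖ < 1) (a : ℝ) :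
    HasFDerivAt (fun y : Euc N => rho y ^ a) ((a * rho x ^ (a + 1)) • innerSL ℝ x) x := by
  have hp := rho_pos hx
  refine ((hasFDerivAt_rho hx).rpow_const (p := a) (Or.inl hp.ne')).congr_fderiv ?_
  rw [smul_smul, mul_assoc, ← Real.rpow_natCast, ← Real.rpow_add hp]
  congr 3
  push_cast
  ring

lemma contDiffAt_rho_rpow {x : Euc N} (hx : ‖x‖ < 1) (a : ℝ) :
    ContDiffAt ℝ 2 (fun y : Euc N => rho y ^ a) x := by
  have h1 : 1 - ‖x‖ ^ 2 ≠ 0 := by nlinarith [norm_nonneg x]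
  have : ContDiffAt ℝ 2 (fun y : Euc N => rho y) x :=
    contDiffAt_const.div (contDiffAt_const.sub (contDiff_norm_sq ℝ).contDiffAt) h1
  exact this.rpow_const_of_ne (rho_pos hx).ne'

lemma lap_rho_rpow {x : Euc N} (hx : ‖x‖ < 1) (a : ℝ) :
    lap (fun y : Euc N => rho y ^ a) x =
      a * (a + 1) * rho x ^ (a + 2) * ‖x‖ ^ 2 + a * N * rho x ^ (a + 1) := by
  have key (i : Fin N) : fderiv ℝ (fun y : Euc N => fderiv ℝ (fun z : Euc N => rho z ^ a) y
      (EuclideanSpace.single i 1)) x (EuclideanSpace.single i 1) =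
      a * (a + 1) * rho x ^ (a + 2) * x i ^ 2 + a * rho x ^ (a + 1) := by
    have he : (fun y : Euc N => fderiv ℝ (fun z : Euc N => rho z ^ a) y
        (EuclideanSpace.single i 1)) =ᶠ[nhds x] fun y => a * (rho y ^ (a + 1) * y i) := by
      filter_upwards [eventually_norm_lt_one hx] with y hy
      rw [(hasFDerivAt_rho_rpow hy a).fderiv]
      simp [EuclideanSpace.inner_single_right, mul_assoc]
    have hc : HasFDerivAt (fun y : Euc N => y i) (EuclideanSpace.proj i : Euc N →L[ℝ] ℝ) x :=
      (EuclideanSpace.proj i : Euc N →L[ℝ] ℝ).hasFDerivAt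
    rw [he.fderiv_eq, (((hasFDerivAt_rho_rpow hx (a + 1)).fun_mul hc).const_mul a).fderiv]
    simp [EuclideanSpace.inner_single_right, show a + 1 + 1 = a + 2 by ring]
    ring
  simp only [lap, key, Finset.sum_add_distrib, ← Finset.mul_sum, EuclideanSpace.real_norm_sq_eq]
  simp
  ring

lemma lap_rho_rpow_half {x : Euc N} (hx : ‖x‖ < 1) :
    lap (fun y : Euc N => rho y ^ (((N : ℝ) - 2) / 2)) x =
      lam0 N * rho x ^ 2 * rho x ^ (((N : ℝ) - 2) / 2) := by
  have hp := rho_pos hx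
  have h1 : 1 - ‖x‖ ^ 2 ≠ 0 := by nlinarith [norm_nonneg x]
  have hr : rho x * (1 - ‖x‖ ^ 2) = 2 := by simp only [rho]; field_simp
  rw [lap_rho_rpow hx, Real.rpow_add hp, Real.rpow_add hp, Real.rpow_one, Real.rpow_two, lam0]
  linear_combination (((N : ℝ) - 2) / 2 * N / 2 * rho x ^ (((N : ℝ) - 2) / 2) * rho x) * (-hr)

variable {f g : Euc N → ℝ} {x : Euc N}

lemma differentiableAt_fderiv_apply (hf : ContDiffAt ℝ 2 f x) (e : Euc N) :
    DifferentiableAt ℝ (fun y => fderiv ℝ f y e) x :=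
  ((hf.fderiv_right (m := 1) (by norm_num)).differentiableAt (by norm_num)).clm_apply
    (differentiableAt_const e)

lemma eventually_differentiableAt (hf : ContDiffAt ℝ 2 f x) :
    ∀ᶠ y in nhds x, DifferentiableAt ℝ f y :=
  (hf.eventually (by simp)).mono fun _ hy => hy.differentiableAt (by norm_num)

lemma fderiv_sq_mul_fderiv (hf : ContDiffAt ℝ 2 f x) (hg : ContDiffAt ℝ 2 g x) (e : Euc N) :
    fderiv ℝ (fun y => f y ^ 2 * fderiv ℝ g y e) x e =
      f x * (fderiv ℝ (fun y => fderiv ℝ (fun z => f z * g z) y e) x e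
        - fderiv ℝ (fun y => fderiv ℝ f y e) x e * g x) := by
  have hf1 := hf.differentiableAt (by norm_num)
  have hg1 := hg.differentiableAt (by norm_num)
  have hf2 := differentiableAt_fderiv_apply hf e
  have hg2 := differentiableAt_fderiv_apply hg e
  have he : (fun y => fderiv ℝ (fun z => f z * g z) y e) =ᶠ[nhds x]
      fun y => f y * fderiv ℝ g y e + g y * fderiv ℝ f y e := by
    filter_upwards [eventually_differentiableAt hf, eventually_differentiableAt hg] with y h1 h2
    simp [fderiv_fun_mul h1 h2]
  rw [he.fderiv_eq, fderiv_fun_add (hf1.fun_mul hg2) (hg1.fun_mul hf2), fderiv_fun_mul hf1 hg2,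
    fderiv_fun_mul hg1 hf2, fderiv_fun_mul (hf1.fun_pow 2) hg2, fderiv_fun_pow 2 hf1]
  simp
  ring

lemma gradient_apply (g : Euc N → ℝ) (x : Euc N) (i : Fin N) :
    gradient g x i = fderiv ℝ g x (EuclideanSpace.single i 1) := by
  rw [← InnerProductSpace.toDual_symm_apply (𝕜 := ℝ), EuclideanSpace.inner_single_right]
  simp [gradient]

lemma ediv_eq_sum {F : Euc N → Euc N} (hF : DifferentiableAt ℝ F x) :
    ediv F x = ∑ i, fderiv ℝ (fun y => F y i) x (EuclideanSpace.single i 1) := by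
  refine Finset.sum_congr rfl fun i _ => ?_
  have hc := (EuclideanSpace.proj i : Euc N →L[ℝ] ℝ).hasFDerivAt.comp x
    hF.hasFDerivAt
  rw [show fderiv ℝ (fun y => F y i) x = _ from hc.fderiv]
  simp [EuclideanSpace.inner_single_right]

lemma ediv_sq_smul_gradient (hf : ContDiffAt ℝ 2 f x) (hg : ContDiffAt ℝ 2 g x) :
    ediv (fun y => f y ^ 2 • gradient g y) x =
      f x * (lap (fun y => f y * g y) x - lap f x * g x) := by
  have hi (i : Fin N) : (fun y => (f y ^ 2 • gradient g y) i) =ᶠ[nhds x]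
      fun y => f y ^ 2 * fderiv ℝ g y (EuclideanSpace.single i 1) :=
    .of_forall fun y => by simp [gradient_apply]
  have hF : DifferentiableAt ℝ (fun y => f y ^ 2 • gradient g y) x := by
    rw [differentiableAt_euclidean]
    exact fun i => (((hf.differentiableAt (by norm_num)).pow 2).mul
      (differentiableAt_fderiv_apply hg _)).congr_of_eventuallyEq (hi i)
  simp only [ediv_eq_sum hF, (hi _).fderiv_eq, fderiv_sq_mul_fderiv hf hg, lap,
    ← Finset.mul_sum, Finset.sum_sub_distrib, Finset.sum_mul]

lemma ediv_rho_rpow_smul_gradient (hx : ‖x‖ < 1) (hg : ContDiffAt ℝ 2 g x) :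
    ediv (fun y => rho y ^ ((N : ℝ) - 2) • gradient g y) x =
      rho x ^ (((N : ℝ) - 2) / 2) *
        (lap (fun y => rho y ^ (((N : ℝ) - 2) / 2) * g y) x
          - lam0 N * rho x ^ 2 * rho x ^ (((N : ℝ) - 2) / 2) * g x) := by
  rw [← lap_rho_rpow_half hx, ← ediv_sq_smul_gradient (contDiffAt_rho_rpow hx _) hg]
  have he : (fun y : Euc N => rho y ^ ((N : ℝ) - 2) • gradient g y) =ᶠ[nhds x]
      fun y => (rho y ^ (((N : ℝ) - 2) / 2)) ^ 2 • gradient g y := by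
    filter_upwards [eventually_norm_lt_one hx] with y hy
    rw [← Real.rpow_mul_natCast (rho_pos hy).le]
    norm_num
  simp only [ediv, he.fderiv_eq]

end Euc

/-- Pointwise equivalence between the hyperbolic eigenvalue-type equation
and the weighted Euclidean eigenvalue equation under `v = ϱ^{(N−2)/2} u`. -/
theorem stmt_1 {N : ℕ} (hN : 3 ≤ N) (Ω : Set (Euc N)) (hΩ : IsOpen Ω)
    (hΩB : Ω ⊆ {x : Euc N | ‖x‖ < 1}) (lam : ℝ) (u : Euc N → ℝ)
    (hu : ContDiffOn ℝ 2 u Ω) (v : Euc N → ℝ)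
    (hv : ∀ x, v x = rho x ^ (((N : ℝ) - 2) / 2) * u x) :
    (∀ x ∈ Ω,
        rho x ^ (-(N : ℝ)) * ediv (fun y => rho y ^ ((N : ℝ) - 2) • gradient u y) x
          + lam * u x = 0)
      ↔ (∀ x ∈ Ω, -lap v x = (lam - lam0 N) * rho x ^ 2 * v x) := by
  refine forall₂_congr fun x hx => ?_
  have hx1 : ‖x‖ < 1 := hΩB hx
  have hp := Euc.rho_pos hx1
  obtain rfl : v = fun y => rho y ^ (((N : ℝ) - 2) / 2) * u y := funext hv
  rw [Euc.ediv_rho_rpow_smul_gradient hx1 (hu.contDiffAt (hΩ.mem_nhds hx))]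
  set L := lap (fun y => rho y ^ (((N : ℝ) - 2) / 2) * u y) x
  set φ := rho x ^ (((N : ℝ) - 2) / 2) with hφ
  have hφ0 : 0 < φ := Real.rpow_pos_of_pos hp _
  have hR : rho x ^ (-(N : ℝ)) * φ ^ 2 * rho x ^ 2 = 1 := by
    rw [hφ, ← Real.rpow_mul_natCast hp.le, ← Real.rpow_natCast (rho x) 2, ← Real.rpow_add hp,
      ← Real.rpow_add hp, ← Real.rpow_zero (rho x)]
    congr 1
    push_cast
    ring
  have hmul : rho x ^ 2 * φ * (rho x ^ (-(N : ℝ)) * (φ * (L - lam0 N * rho x ^ 2 * φ * u x))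
      + lam * u x) = (lam - lam0 N) * rho x ^ 2 * (φ * u x) + L := by
    linear_combination (L - lam0 N * rho x ^ 2 * φ * u x) * hR
  have hne : rho x ^ 2 * φ ≠ 0 := by positivity
  rw [← mul_eq_zero_iff_left hne, hmul]
  constructor <;> intro h <;> linarith
end
end

section
/- Let N ≥ 4 and λ > λ₀. Let 0 < r < 1 and let φ be a smooth radial function (i.e., φ(x) depends only on |x|) with compact support contained in the open ball {x : |x| < r}, satisfying φ ≡ 1 on some neighborhood of the origin. For ε > 0 set φ_ε(x) = φ(x) U_{ε,0}(x). Then there exists ε > 0 such that ( ∫ |∇φ_ε|² dx − (λ − λ₀) ∫ ϱ² φ_ε² dx ) / ( ∫ |φ_ε|^{2*} dx )^{2/2*} < S, where all integrals are over the ball {x : |x| < r}. -/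
open MeasureTheory Real RealInnerProductSpace

noncomputable section

/-- The Aubin–Talenti instanton `U_{ε,y}`. -/
def instanton (N : ℕ) (ε : ℝ) (y : Euc N) (x : Euc N) : ℝ :=
  ((N : ℝ) * ((N : ℝ) - 2)) ^ (((N : ℝ) - 2) / 4) *
    (ε / (ε ^ 2 + ‖x - y‖ ^ 2)) ^ (((N : ℝ) - 2) / 2)

/-- The best constant of the Euclidean Sobolev embedding `D^{1,2}(ℝ^N) ↪ L^{2*}(ℝ^N)`,
expressed as an infimum of Rayleigh quotients over nontrivial test functions. -/
def sobolevS (N : ℕ) : ℝ :=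
  sInf { c : ℝ | ∃ w : Euc N → ℝ, ContDiff ℝ (⊤ : ℕ∞) w ∧ HasCompactSupport w ∧ w ≠ 0 ∧
    c = (∫ x, ‖gradient w x‖ ^ 2) / (∫ x, |w x| ^ twoStar N) ^ (2 / twoStar N) }

/-! ### Monotone transport on the line -/

/-- The normalized distribution function of a density on the line. -/
def normCdf (f : ℝ → ℝ) (s : ℝ) : ℝ := (∫ t in Set.Iic s, f t) / ∫ t, f t

/-- The monotone map transporting the normalized density `f` to the normalized density `g`. -/
def monoTransport (f g : ℝ → ℝ) (s : ℝ) : ℝ := Function.invFun (normCdf g) (normCdf f s)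

section Line

variable {f g : ℝ → ℝ}

lemma integral_pos_of_continuous_pos (hpos : ∀ s, 0 < f s) (hi : Integrable f) :
    0 < ∫ t, f t := by
  rw [integral_pos_iff_support_of_nonneg (fun s => (hpos s).le) hi]
  have : Function.support f = Set.univ := Set.eq_univ_of_forall fun s => (hpos s).ne'
  simp [this]

lemma hasDerivAt_normCdf (hc : Continuous f) (hi : Integrable f) (s : ℝ) :
    HasDerivAt (normCdf f) (f s / ∫ t, f t) s := by
  have h1 : HasDerivAt (fun u => ∫ t in s..u, f t) (f s) s :=
    intervalIntegral.integral_hasDerivAt_right (hc.intervalIntegrable _ _)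
      hc.stronglyMeasurable.stronglyMeasurableAtFilter hc.continuousAt
  have h2 : (fun u => ∫ t in Set.Iic u, f t) =
      fun u => (∫ t in Set.Iic s, f t) + ∫ t in s..u, f t := by
    funext u
    rw [← intervalIntegral.integral_Iic_sub_Iic hi.integrableOn hi.integrableOn]
    ring
  have h3 : HasDerivAt (fun u => ∫ t in Set.Iic u, f t) (f s) s := by
    rw [h2]
    exact h1.const_add _
  exact h3.div_const _

lemma strictMono_normCdf (hc : Continuous f) (hpos : ∀ s, 0 < f s) (hi : Integrable f) :
    StrictMono (normCdf f) :=
  strictMono_of_deriv_pos fun s => by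
    rw [(hasDerivAt_normCdf hc hi s).deriv]
    exact div_pos (hpos s) (integral_pos_of_continuous_pos hpos hi)

lemma tendsto_normCdf_atTop (hpos : ∀ s, 0 < f s) (hi : Integrable f) :
    Filter.Tendsto (normCdf f) Filter.atTop (nhds 1) := by
  have h := (aecover_Iic (μ := (volume : Measure ℝ)) Filter.tendsto_id
    ).integral_tendsto_of_countably_generated hi
  have h2 := h.div_const (∫ t, f t)
  rwa [div_self (integral_pos_of_continuous_pos hpos hi).ne'] at h2

lemma tendsto_normCdf_atBot (hi : Integrable f) :
    Filter.Tendsto (normCdf f) Filter.atBot (nhds 0) := by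
  have h := (aecover_Ioi (μ := (volume : Measure ℝ)) Filter.tendsto_id
    ).integral_tendsto_of_countably_generated hi
  have h2 := (h.const_sub (∫ t, f t)).div_const (∫ t, f t)
  rw [sub_self, zero_div] at h2
  refine h2.congr fun s => ?_
  have := intervalIntegral.integral_Iic_add_Ioi (b := s) hi.integrableOn hi.integrableOn
  simp only [normCdf, id]
  rw [← this]
  ring

lemma normCdf_mem_Ioo (hc : Continuous f) (hpos : ∀ s, 0 < f s) (hi : Integrable f) (s : ℝ) :
    normCdf f s ∈ Set.Ioo (0 : ℝ) 1 := by
  have hm := strictMono_normCdf hc hpos hi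
  constructor
  · exact (hm.monotone.le_of_tendsto (tendsto_normCdf_atBot hi) (s - 1)).trans_lt
      (hm (by linarith))
  · exact (hm (by linarith : s < s + 1)).trans_le
      (hm.monotone.ge_of_tendsto (tendsto_normCdf_atTop hpos hi) (s + 1))

lemma exists_normCdf_eq (hc : Continuous f) (hpos : ∀ s, 0 < f s) (hi : Integrable f) {c : ℝ}
    (h : c ∈ Set.Ioo (0 : ℝ) 1) : ∃ s, normCdf f s = c := by
  have hcont : Continuous (normCdf f) :=
    continuous_iff_continuousAt.2 fun s => (hasDerivAt_normCdf hc hi s).continuousAt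
  refine mem_range_of_exists_le_of_exists_ge hcont ?_ ?_
  · exact (((tendsto_normCdf_atBot hi).eventually (gt_mem_nhds h.1)).exists).imp
      fun _ => le_of_lt
  · exact (((tendsto_normCdf_atTop hpos hi).eventually (lt_mem_nhds h.2)).exists).imp
      fun _ => le_of_lt

lemma normCdf_monoTransport (hf : Continuous f) (hfp : ∀ s, 0 < f s) (hfi : Integrable f)
    (hg : Continuous g) (hgp : ∀ s, 0 < g s) (hgi : Integrable g) (s : ℝ) :
    normCdf g (monoTransport f g s) = normCdf f s :=
  Function.invFun_eq (exists_normCdf_eq hg hgp hgi (normCdf_mem_Ioo hf hfp hfi s))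

lemma monoTransport_le_iff (hf : Continuous f) (hfp : ∀ s, 0 < f s) (hfi : Integrable f)
    (hg : Continuous g) (hgp : ∀ s, 0 < g s) (hgi : Integrable g) (s c : ℝ) :
    monoTransport f g s ≤ c ↔ normCdf f s ≤ normCdf g c := by
  rw [← (strictMono_normCdf hg hgp hgi).le_iff_le,
    normCdf_monoTransport hf hfp hfi hg hgp hgi]

lemma strictMono_monoTransport (hf : Continuous f) (hfp : ∀ s, 0 < f s) (hfi : Integrable f)
    (hg : Continuous g) (hgp : ∀ s, 0 < g s) (hgi : Integrable g) :
    StrictMono (monoTransport f g) := fun s t hst => by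
  rw [← (strictMono_normCdf hg hgp hgi).lt_iff_lt,
    normCdf_monoTransport hf hfp hfi hg hgp hgi, normCdf_monoTransport hf hfp hfi hg hgp hgi]
  exact strictMono_normCdf hf hfp hfi hst

lemma surjective_monoTransport (hf : Continuous f) (hfp : ∀ s, 0 < f s) (hfi : Integrable f)
    (hg : Continuous g) (hgp : ∀ s, 0 < g s) (hgi : Integrable g) :
    Function.Surjective (monoTransport f g) := fun t => by
  obtain ⟨s, hs⟩ := exists_normCdf_eq hf hfp hfi (normCdf_mem_Ioo hg hgp hgi t)
  refine ⟨s, (strictMono_normCdf hg hgp hgi).injective ?_⟩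
  rw [normCdf_monoTransport hf hfp hfi hg hgp hgi, hs]

lemma hasDerivAt_monoTransport (hf : Continuous f) (hfp : ∀ s, 0 < f s) (hfi : Integrable f)
    (hg : Continuous g) (hgp : ∀ s, 0 < g s) (hgi : Integrable g) (s : ℝ) :
    HasDerivAt (monoTransport f g)
      ((f s / ∫ t, f t) * ((∫ t, g t) / g (monoTransport f g s))) s := by
  have hmono := strictMono_normCdf hg hgp hgi
  have hinv : ∀ c ∈ Set.Ioo (0 : ℝ) 1, normCdf g (Function.invFun (normCdf g) c) = c :=
    fun c hc => Function.invFun_eq (exists_normCdf_eq hg hgp hgi hc)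
  have hmem := normCdf_mem_Ioo hf hfp hfi s
  have hnhds : Set.Ioo (0 : ℝ) 1 ∈ nhds (normCdf f s) := isOpen_Ioo.mem_nhds hmem
  have hcont : ContinuousAt (Function.invFun (normCdf g)) (normCdf f s) := by
    refine StrictMonoOn.continuousAt_of_image_mem_nhds (s := Set.Ioo (0 : ℝ) 1) ?_ hnhds ?_
    · intro a ha b hb hab
      rwa [← hmono.lt_iff_lt, hinv a ha, hinv b hb]
    · convert Filter.univ_mem
      refine Set.eq_univ_of_forall fun t => ⟨normCdf g t, normCdf_mem_Ioo hg hgp hgi t, ?_⟩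
      exact Function.leftInverse_invFun hmono.injective t
  have hd : HasDerivAt (Function.invFun (normCdf g))
      (g (monoTransport f g s) / ∫ t, g t)⁻¹ (normCdf f s) :=
    HasDerivAt.of_local_left_inverse hcont (hasDerivAt_normCdf hg hgi _)
      (div_pos (hgp _) (integral_pos_of_continuous_pos hgp hgi)).ne'
      (Filter.eventually_of_mem hnhds hinv)
  have := hd.comp s (hasDerivAt_normCdf hf hfi s)
  rw [inv_div, mul_comm] at this
  exact this

/-- The change of variables formula for the monotone transport. -/
lemma lintegral_comp_monoTransport (hf : Continuous f) (hfp : ∀ s, 0 < f s) (hfi : Integrable f)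
    (hg : Continuous g) (hgp : ∀ s, 0 < g s) (hgi : Integrable g) (ψ : ℝ → ENNReal) :
    ∫⁻ s, ψ (monoTransport f g s) * ENNReal.ofReal (f s / ∫ t, f t) =
      ∫⁻ t, ψ t * ENNReal.ofReal (g t / ∫ t, g t) := by
  have hf0 := integral_pos_of_continuous_pos hfp hfi
  have hg0 := integral_pos_of_continuous_pos hgp hgi
  have h := lintegral_image_eq_lintegral_abs_deriv_mul (s := Set.univ) MeasurableSet.univ
    (fun s _ => (hasDerivAt_monoTransport hf hfp hfi hg hgp hgi s).hasDerivWithinAt)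
    (strictMono_monoTransport hf hfp hfi hg hgp hgi).injective.injOn
    (fun t => ψ t * ENNReal.ofReal (g t / ∫ t, g t))
  rw [Set.image_univ, (surjective_monoTransport hf hfp hfi hg hgp hgi).range_eq,
    Measure.restrict_univ] at h
  rw [h]
  refine lintegral_congr fun s => ?_
  have hp := hgp (monoTransport f g s)
  have hp' := hfp s
  rw [abs_of_pos (by positivity), mul_left_comm, ← ENNReal.ofReal_mul (by positivity)]
  congr 2
  field_simp

end Line

/-! ### The Knothe map -/

/-- A continuous positive function on `ℝⁿ` dominated by a product of Cauchy densities. -/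
structure IsTransportDensity {n : ℕ} (F : (Fin n → ℝ) → ℝ) : Prop where
  continuous : Continuous F
  pos : ∀ x, 0 < F x
  bound : ∃ C, ∀ x, F x ≤ C * ∏ i, (1 + x i ^ 2)⁻¹

/-- The marginal obtained by integrating out the first coordinate. -/
def tailMarginal {n : ℕ} (F : (Fin (n + 1) → ℝ) → ℝ) (x : Fin n → ℝ) : ℝ :=
  ∫ s, F (Fin.cons s x)

namespace IsTransportDensity

lemma integrable {n : ℕ} {F : (Fin n → ℝ) → ℝ} (hF : IsTransportDensity F) : Integrable F := by
  obtain ⟨C, hC⟩ := hF.bound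
  have h : Integrable (fun x : Fin n → ℝ => ∏ i, (1 + x i ^ 2)⁻¹) :=
    Integrable.fintype_prod (f := fun _ s => (1 + s ^ 2)⁻¹) fun _ => integrable_inv_one_add_sq
  refine (h.const_mul C).mono' hF.continuous.aestronglyMeasurable (.of_forall fun x => ?_)
  rw [Real.norm_of_nonneg (hF.pos x).le]
  exact hC x

variable {n : ℕ} {F G : (Fin (n + 1) → ℝ) → ℝ}

lemma continuous_cons (hF : IsTransportDensity F) (x : Fin n → ℝ) :
    Continuous fun s : ℝ => F (Fin.cons s x) :=
  hF.continuous.comp (Continuous.finCons continuous_id continuous_const)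

lemma exists_cons_le (hF : IsTransportDensity F) :
    ∃ C, 0 ≤ C ∧ ∀ (s : ℝ) (x : Fin n → ℝ),
      F (Fin.cons s x) ≤ C * (1 + s ^ 2)⁻¹ * ∏ i, (1 + x i ^ 2)⁻¹ := by
  obtain ⟨C, hC⟩ := hF.bound
  refine ⟨C, ?_, fun s x => ?_⟩
  · have h := (hF.pos 0).trans_le (hC 0)
    simp only [Pi.zero_apply] at h
    norm_num at h
    exact h.le
  · have := hC (Fin.cons s x)
    rw [Fin.prod_univ_succ] at this
    simpa [mul_assoc] using this

lemma integrable_cons (hF : IsTransportDensity F) (x : Fin n → ℝ) :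
    Integrable fun s : ℝ => F (Fin.cons s x) := by
  obtain ⟨C, -, hC⟩ := hF.exists_cons_le
  refine ((integrable_inv_one_add_sq.const_mul C).mul_const (∏ i, (1 + x i ^ 2)⁻¹)).mono'
    (hF.continuous_cons x).aestronglyMeasurable (.of_forall fun s => ?_)
  rw [Real.norm_of_nonneg (hF.pos _).le]
  exact hC s x

lemma tailMarginal (hF : IsTransportDensity F) : IsTransportDensity (tailMarginal F) := by
  obtain ⟨C, hC0, hC⟩ := hF.exists_cons_le
  have hle : ∀ x : Fin n → ℝ, ∏ i, (1 + x i ^ 2)⁻¹ ≤ 1 := fun x =>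
    Finset.prod_le_one (fun i _ => by positivity) fun i _ =>
      inv_le_one_of_one_le₀ (by nlinarith [sq_nonneg (x i)])
  refine ⟨?_, fun x => ?_, ⟨C * ∫ s : ℝ, (1 + s ^ 2)⁻¹, fun x => ?_⟩⟩
  · refine continuous_of_dominated (bound := fun s : ℝ => C * (1 + s ^ 2)⁻¹)
      (fun x => (hF.continuous_cons x).aestronglyMeasurable)
      (fun x => .of_forall fun s => ?_) (integrable_inv_one_add_sq.const_mul C)
      (.of_forall fun s => hF.continuous.comp (Continuous.finCons continuous_const continuous_id))
    rw [Real.norm_of_nonneg (hF.pos _).le]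
    exact (hC s x).trans (mul_le_of_le_one_right (by positivity) (hle x))
  · exact integral_pos_of_continuous_pos (fun s => hF.pos _) (hF.integrable_cons x)
  · calc (∫ s, F (Fin.cons s x))
        ≤ ∫ s : ℝ, C * (1 + s ^ 2)⁻¹ * ∏ i, (1 + x i ^ 2)⁻¹ :=
          integral_mono (hF.integrable_cons x)
            ((integrable_inv_one_add_sq.const_mul C).mul_const _) fun s => hC s x
      _ = _ := by rw [integral_mul_const, integral_const_mul]

end IsTransportDensity

lemma lintegral_fin_succ {n : ℕ} {f : (Fin (n + 1) → ℝ) → ENNReal} (hf : Measurable f) :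
    ∫⁻ x, f x = ∫⁻ x : Fin n → ℝ, ∫⁻ s : ℝ, f (Fin.cons s x) := by
  have h := (volume_preserving_piFinSuccAbove (fun _ : Fin (n + 1) => ℝ) 0).symm
  rw [← h.lintegral_comp hf, Measure.volume_eq_prod, lintegral_prod_symm]
  · simp [MeasurableEquiv.piFinSuccAbove_symm_apply, Fin.insertNthEquiv]
  · exact (hf.comp (MeasurableEquiv.measurable _)).aemeasurable

lemma measurable_fin_cons {n : ℕ} :
    Measurable fun p : ℝ × (Fin n → ℝ) => (Fin.cons p.1 p.2 : Fin (n + 1) → ℝ) :=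
  (Continuous.finCons (A := fun _ => ℝ) continuous_fst continuous_snd).measurable

lemma integral_tailMarginal {n : ℕ} {F : (Fin (n + 1) → ℝ) → ℝ} (hF : IsTransportDensity F) :
    ∫ x, tailMarginal F x = ∫ x, F x := by
  rw [integral_eq_lintegral_of_nonneg_ae (.of_forall fun x => (hF.pos x).le)
      hF.continuous.aestronglyMeasurable,
    integral_eq_lintegral_of_nonneg_ae (.of_forall fun x => (hF.tailMarginal.pos x).le)
      hF.tailMarginal.continuous.aestronglyMeasurable,
    lintegral_fin_succ (by exact hF.continuous.measurable.ennreal_ofReal)]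
  congr 1
  refine lintegral_congr fun x => ?_
  exact ofReal_integral_eq_lintegral_ofReal (hF.integrable_cons x)
    (.of_forall fun s => (hF.pos _).le)

lemma measurable_normCdf_param {α : Type*} [MeasurableSpace α] {f : α → ℝ → ℝ}
    (hf : Measurable fun p : α × ℝ => f p.1 p.2) :
    Measurable fun p : α × ℝ => normCdf (f p.1) p.2 := by
  refine Measurable.div ?_ ?_
  · have h : ∀ p : α × ℝ, ∫ t in Set.Iic p.2, f p.1 t =
        ∫ t, Set.indicator {q : (α × ℝ) × ℝ | q.2 ≤ q.1.2} (fun q => f q.1.1 q.2) (p, t) := by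
      intro p
      rw [← integral_indicator measurableSet_Iic]
      rfl
    simp only [h]
    refine (StronglyMeasurable.integral_prod_right (ν := (volume : Measure ℝ)) ?_).measurable
    refine Measurable.stronglyMeasurable (Measurable.indicator ?_ ?_)
    · exact hf.comp ((measurable_fst.comp measurable_fst).prodMk measurable_snd)
    · exact measurableSet_le measurable_snd (measurable_snd.comp measurable_fst)
  · exact ((StronglyMeasurable.integral_prod_right (ν := (volume : Measure ℝ))
      hf.stronglyMeasurable).measurable).comp measurable_fst

/-- The data of a Knothe map `T` from the density `F` to the density `G`,
with diagonal derivatives `a`. -/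
structure IsKnotheMap {n : ℕ} (F G : (Fin n → ℝ) → ℝ) (T a : (Fin n → ℝ) → Fin n → ℝ) : Prop where
  measurable : Measurable T
  measurable_diag : Measurable a
  diag_pos : ∀ x i, 0 < a x i
  hasDerivAt : ∀ x i, HasDerivAt (fun s => T (Function.update x i s) i) (a x i) (x i)
  continuous_diag : ∀ x i, Continuous fun s => a (Function.update x i s) i
  jacobian : ∀ x, G (T x) * ∏ i, a x i = F x
  lintegral_comp : ∀ φ : (Fin n → ℝ) → ENNReal, Measurable φ →
    ∫⁻ x, φ (T x) * ENNReal.ofReal (F x) = ∫⁻ y, φ y * ENNReal.ofReal (G y)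

theorem exists_isKnotheMap : ∀ {n : ℕ} {F G : (Fin n → ℝ) → ℝ}, IsTransportDensity F →
    IsTransportDensity G → ∫ x, F x = ∫ x, G x → ∃ T a, IsKnotheMap F G T a
  | 0, F, G, _, _, h => by
    have hc : ∀ H : (Fin 0 → ℝ) → ℝ, ∫ x, H x = H default := fun H => by
      rw [integral_unique]
      simp only [Measure.real, volume_pi, Measure.pi_empty_univ, ENNReal.toReal_one, one_smul]
      exact congrArg H (Subsingleton.elim _ _)
    have hFG : F = G := by
      funext x
      rw [Subsingleton.elim x default, ← hc F, ← hc G, h]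
    subst hFG
    exact ⟨id, fun _ _ => 1, measurable_id, measurable_const, fun _ i => i.elim0,
      fun _ i => i.elim0, fun _ i => i.elim0, fun x => by simp, fun φ _ => rfl⟩
  | n + 1, F, G, hF, hG, h => by
    obtain ⟨T', a', hT⟩ := exists_isKnotheMap hF.tailMarginal hG.tailMarginal
      (by rw [integral_tailMarginal hF, integral_tailMarginal hG, h])
    let f : (Fin n → ℝ) → ℝ → ℝ := fun x s => F (Fin.cons s x)
    let g : (Fin n → ℝ) → ℝ → ℝ := fun x s => G (Fin.cons s (T' x))
    let τ : (Fin n → ℝ) → ℝ → ℝ := fun x => monoTransport (f x) (g x)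
    let b : (Fin n → ℝ) → ℝ → ℝ := fun x s =>
      (f x s / tailMarginal F x) * (tailMarginal G (T' x) / g x (τ x s))
    have hf : ∀ x, Continuous (f x) := hF.continuous_cons
    have hfp : ∀ x s, 0 < f x s := fun x s => hF.pos _
    have hfi : ∀ x, Integrable (f x) := hF.integrable_cons
    have hg : ∀ x, Continuous (g x) := fun x => hG.continuous_cons _
    have hgp : ∀ x s, 0 < g x s := fun x s => hG.pos _
    have hgi : ∀ x, Integrable (g x) := fun x => hG.integrable_cons _
    have hFp := hF.tailMarginal.pos
    have hGp := hG.tailMarginal.pos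
    have hτd : ∀ x s, HasDerivAt (τ x) (b x s) s := fun x s =>
      hasDerivAt_monoTransport (hf x) (hfp x) (hfi x) (hg x) (hgp x) (hgi x) s
    have hτc : ∀ x, Continuous (τ x) := fun x =>
      continuous_iff_continuousAt.2 fun s => (hτd x s).continuousAt
    have hbp : ∀ x s, 0 < b x s := fun x s =>
      mul_pos (div_pos (hfp x s) (hFp x)) (div_pos (hGp _) (hgp _ _))
    have hbc : ∀ x, Continuous (b x) := fun x =>
      ((hf x).div_const _).mul
        (continuous_const.div ((hg x).comp (hτc x)) fun s => (hgp _ _).ne')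
    have hfm : Measurable fun p : (Fin n → ℝ) × ℝ => f p.1 p.2 :=
      hF.continuous.measurable.comp (measurable_fin_cons.comp measurable_swap)
    have hgm : Measurable fun p : (Fin n → ℝ) × ℝ => g p.1 p.2 :=
      hG.continuous.measurable.comp (measurable_fin_cons.comp
        (measurable_snd.prodMk (hT.measurable.comp measurable_fst)))
    have hτm : Measurable fun p : (Fin n → ℝ) × ℝ => τ p.1 p.2 := by
      refine measurable_of_Iic fun c => ?_
      have : (fun p : (Fin n → ℝ) × ℝ => τ p.1 p.2) ⁻¹' Set.Iic c =
          {p | normCdf (f p.1) p.2 ≤ normCdf (g p.1) c} := by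
        ext p
        exact monoTransport_le_iff (hf _) (hfp _) (hfi _) (hg _) (hgp _) (hgi _) _ _
      rw [this]
      exact measurableSet_le (measurable_normCdf_param hfm)
        ((measurable_normCdf_param hgm).comp (measurable_fst.prodMk measurable_const))
    have hbm : Measurable fun p : (Fin n → ℝ) × ℝ => b p.1 p.2 := by
      refine (hfm.div ?_).mul (Measurable.div ?_ ?_)
      · exact hF.tailMarginal.continuous.measurable.comp measurable_fst
      · exact hG.tailMarginal.continuous.measurable.comp (hT.measurable.comp measurable_fst)
      · exact hgm.comp (measurable_fst.prodMk hτm)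
    have htl : Measurable fun x : Fin (n + 1) → ℝ => (Fin.tail x, x 0) :=
      (measurable_pi_lambda _ fun i => measurable_pi_apply _).prodMk (measurable_pi_apply _)
    have hu0 : ∀ (x : Fin (n + 1) → ℝ) s, Fin.tail (Function.update x 0 s) = Fin.tail x :=
      fun x s => Fin.tail_update_zero x s
    have hus : ∀ (x : Fin (n + 1) → ℝ) (i : Fin n) s,
        Fin.tail (Function.update x i.succ s) = Function.update (Fin.tail x) i s :=
      fun x i s => Fin.tail_update_succ x i s
    refine ⟨fun x => Fin.cons (τ (Fin.tail x) (x 0)) (T' (Fin.tail x)),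
      fun x => Fin.cons (b (Fin.tail x) (x 0)) (a' (Fin.tail x)), ?_, ?_, ?_, ?_, ?_, ?_, ?_⟩
    · exact measurable_fin_cons.comp ((hτm.comp htl).prodMk
        (hT.measurable.comp (measurable_fst.comp htl)))
    · exact measurable_fin_cons.comp ((hbm.comp htl).prodMk
        (hT.measurable_diag.comp (measurable_fst.comp htl)))
    · intro x i
      refine Fin.cases ?_ (fun i => ?_) i
      · exact hbp _ _
      · exact hT.diag_pos _ _
    · intro x i
      refine Fin.cases ?_ (fun i => ?_) i
      · simpa [hu0] using hτd (Fin.tail x) (x 0)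
      · simpa [hus, Fin.tail] using hT.hasDerivAt (Fin.tail x) i
    · intro x i
      refine Fin.cases ?_ (fun i => ?_) i
      · simpa [hu0] using hbc (Fin.tail x)
      · simpa [hus] using hT.continuous_diag (Fin.tail x) i
    · intro x
      have hj := hT.jacobian (Fin.tail x)
      rw [Fin.prod_univ_succ]
      simp only [Fin.cons_zero, Fin.cons_succ]
      have h1 : F x = f (Fin.tail x) (x 0) := by
        simp only [f, Fin.cons_self_tail]
      have h2 := hgp (Fin.tail x) (τ (Fin.tail x) (x 0))
      have h3 := hFp (Fin.tail x)
      have h4 := hGp (T' (Fin.tail x))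
      have h5 : G (Fin.cons (τ (Fin.tail x) (x 0)) (T' (Fin.tail x))) =
        g (Fin.tail x) (τ (Fin.tail x) (x 0)) := rfl
      rw [h5, h1]
      simp only [b]
      have h6 : ∏ i, a' (Fin.tail x) i = tailMarginal F (Fin.tail x) /
          tailMarginal G (T' (Fin.tail x)) := by
        rw [eq_div_iff h4.ne', mul_comm, hj]
      rw [h6]
      field_simp
    · intro φ hφ
      have hmφ : Measurable fun x : Fin (n + 1) → ℝ =>
          φ (Fin.cons (τ (Fin.tail x) (x 0)) (T' (Fin.tail x))) :=
        hφ.comp (measurable_fin_cons.comp ((hτm.comp htl).prodMk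
          (hT.measurable.comp (measurable_fst.comp htl))))
      rw [lintegral_fin_succ (by exact hmφ.mul hF.continuous.measurable.ennreal_ofReal),
        lintegral_fin_succ (by exact hφ.mul hG.continuous.measurable.ennreal_ofReal)]
      simp only [Fin.cons_zero, Fin.tail_cons]
      let Ψ : (Fin n → ℝ) → ENNReal := fun y =>
        ∫⁻ t, φ (Fin.cons t y) * ENNReal.ofReal (G (Fin.cons t y) / tailMarginal G y)
      have hΨm : Measurable Ψ := by
        refine Measurable.lintegral_prod_right' (f := fun p : (Fin n → ℝ) × ℝ =>
          φ (Fin.cons p.2 p.1) * ENNReal.ofReal (G (Fin.cons p.2 p.1) / tailMarginal G p.1)) ?_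
        have hc := (measurable_fin_cons (n := n)).comp measurable_swap
        exact (hφ.comp hc).mul (((hG.continuous.measurable.comp hc).div
          (hG.tailMarginal.continuous.measurable.comp measurable_fst)).ennreal_ofReal)
      have key : ∀ {H : (Fin (n + 1) → ℝ) → ℝ} (hH : IsTransportDensity H) (χ : ℝ → ENNReal)
          (hχ : Measurable χ) (y : Fin n → ℝ),
          ∫⁻ t, χ t * ENNReal.ofReal (H (Fin.cons t y)) =
            (∫⁻ t, χ t * ENNReal.ofReal (H (Fin.cons t y) / tailMarginal H y)) *
              ENNReal.ofReal (tailMarginal H y) := by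
        intro H hH χ hχ y
        rw [← lintegral_mul_const]
        · refine lintegral_congr fun t => ?_
          rw [mul_assoc, ← ENNReal.ofReal_mul
            (div_nonneg (hH.pos _).le (hH.tailMarginal.pos y).le),
            div_mul_cancel₀ _ (hH.tailMarginal.pos y).ne']
        · exact hχ.mul ((hH.continuous_cons y).measurable.div_const _).ennreal_ofReal
      have hφc : ∀ y : Fin n → ℝ, Measurable fun t : ℝ => φ (Fin.cons t y) := fun y =>
        hφ.comp (Continuous.finCons (A := fun _ => ℝ) continuous_id continuous_const).measurable
      calc ∫⁻ x : Fin n → ℝ, ∫⁻ s : ℝ,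
            φ (Fin.cons (τ x s) (T' x)) * ENNReal.ofReal (F (Fin.cons s x))
          = ∫⁻ x, Ψ (T' x) * ENNReal.ofReal (tailMarginal F x) := by
            refine lintegral_congr fun x => ?_
            rw [key hF (fun s => φ (Fin.cons (τ x s) (T' x)))
              ((hφc (T' x)).comp (hτc x).measurable) x]
            congr 1
            exact lintegral_comp_monoTransport (hf x) (hfp x) (hfi x) (hg x) (hgp x) (hgi x)
              fun t => φ (Fin.cons t (T' x))
        _ = ∫⁻ y, Ψ y * ENNReal.ofReal (tailMarginal G y) := hT.lintegral_comp Ψ hΨm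
        _ = _ := lintegral_congr fun y => (key hG _ (hφc y) y).symm

/-! ### The sharp Sobolev inequality by mass transport -/

lemma lintegral_pi_mono_of_line {n : ℕ} {f g : (Fin n → ℝ) → ENNReal} (hf : Measurable f)
    (hg : Measurable g) (i : Fin n)
    (h : ∀ x : Fin n → ℝ,
      ∫⁻ s : ℝ, f (Function.update x i s) ≤ ∫⁻ s : ℝ, g (Function.update x i s)) :
    ∫⁻ x, f x ≤ ∫⁻ x, g x := by
  rw [volume_pi, lintegral_eq_lmarginal_univ 0, lintegral_eq_lmarginal_univ 0,
    lmarginal_erase' f hf (Finset.mem_univ i), lmarginal_erase' g hg (Finset.mem_univ i)]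
  exact lmarginal_mono h 0

lemma lintegral_mul_deriv_le {u u' v v' : ℝ → ℝ} (hu : ∀ s, HasDerivAt u (u' s) s)
    (hv : ∀ s, HasDerivAt v (v' s) s) (hu'c : Continuous u') (hv'c : Continuous v')
    (hus : HasCompactSupport u) (hu's : HasCompactSupport u') (hu0 : ∀ s, 0 ≤ u s)
    (hv0 : ∀ s, 0 ≤ v' s) :
    ∫⁻ s, ENNReal.ofReal (u s * v' s) ≤ ∫⁻ s, ENNReal.ofReal (|u' s| * |v s|) := by
  have huc : Continuous u := continuous_iff_continuousAt.2 fun s => (hu s).continuousAt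
  have hvc : Continuous v := continuous_iff_continuousAt.2 fun s => (hv s).continuousAt
  have i1 : Integrable (u * v') := (huc.mul hv'c).integrable_of_hasCompactSupport hus.mul_right
  have i2 : Integrable (u' * v) := (hu'c.mul hvc).integrable_of_hasCompactSupport hu's.mul_right
  have i3 : Integrable (u * v) := (huc.mul hvc).integrable_of_hasCompactSupport hus.mul_right
  have h := integral_mul_deriv_eq_deriv_mul_of_integrable (fun s _ => hu s) (fun s _ => hv s)
    i1 i2 i3
  have hle : ∫ s, u s * v' s ≤ ∫ s, |u' s| * |v s| := by
    rw [h, ← integral_neg]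
    refine integral_mono i2.neg ?_ fun s => ?_
    · simpa only [Pi.mul_apply, abs_mul] using i2.abs
    · simpa only [Pi.mul_apply, abs_mul] using neg_le_abs (u' s * v s)
  rw [← ofReal_integral_eq_lintegral_ofReal (f := fun s => u s * v' s) i1
      (.of_forall fun s => mul_nonneg (hu0 s) (hv0 s)),
    ← ofReal_integral_eq_lintegral_ofReal (f := fun s => |u' s| * |v s|)
      (by simpa only [Pi.mul_apply, abs_mul] using i2.abs)
      (.of_forall fun s => by positivity)]
  exact ENNReal.ofReal_le_ofReal hle

lemma IsKnotheMap.lintegral_mul_diag_le {n : ℕ} {F G : (Fin n → ℝ) → ℝ}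
    {T a : (Fin n → ℝ) → Fin n → ℝ} (hT : IsKnotheMap F G T a) {h : (Fin n → ℝ) → ℝ}
    (hh : ContDiff ℝ 1 h) (hs : HasCompactSupport h) (h0 : ∀ x, 0 ≤ h x) (i : Fin n) :
    ∫⁻ x, ENNReal.ofReal (h x * a x i) ≤
      ∫⁻ x, ENNReal.ofReal (|fderiv ℝ h x (Pi.single i 1)| * |T x i|) := by
  have hd : Continuous fun x => fderiv ℝ h x (Pi.single i 1) :=
    (hh.continuous_fderiv one_ne_zero).clm_apply continuous_const
  refine lintegral_pi_mono_of_line ?_ ?_ i fun x => ?_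
  · exact (hh.continuous.measurable.mul
      ((measurable_pi_apply i).comp hT.measurable_diag)).ennreal_ofReal
  · exact (hd.measurable.abs.mul
      ((measurable_pi_apply i).comp hT.measurable).abs).ennreal_ofReal
  have hup : Continuous fun s : ℝ => Function.update x i s := continuous_const.update i continuous_id
  have hemb := isClosedEmbedding_update x i
  refine lintegral_mul_deriv_le (u := fun s => h (Function.update x i s))
    (u' := fun s => fderiv ℝ h (Function.update x i s) (Pi.single i 1))
    (v := fun s => T (Function.update x i s) i) (v' := fun s => a (Function.update x i s) i)
    (fun s => ?_) (fun s => ?_) (hd.comp hup) (hT.continuous_diag x i)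
    (hs.comp_isClosedEmbedding hemb) ((hs.fderiv_apply ℝ _).comp_isClosedEmbedding hemb)
    (fun s => h0 _) (fun s => (hT.diag_pos _ _).le)
  · exact ((hh.differentiable one_ne_zero) _).hasFDerivAt.comp_hasDerivAt s
      (hasDerivAt_update x i s)
  · simpa using hT.hasDerivAt (Function.update x i s) i

lemma hasCompactSupport_abs_rpow {E : Type*} [TopologicalSpace E] {w : E → ℝ}
    (hs : HasCompactSupport w) {q : ℝ} (hq : 0 < q) : HasCompactSupport fun x => |w x| ^ q :=
  hs.comp_left (g := fun t : ℝ => |t| ^ q) (by simp [hq.ne'])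

/-- The squared length of the gradient in coordinates. -/
def gradSq {n : ℕ} (w : (Fin n → ℝ) → ℝ) (x : Fin n → ℝ) : ℝ :=
  ∑ i, fderiv ℝ w x (Pi.single i 1) ^ 2

lemma continuous_gradSq {n : ℕ} {w : (Fin n → ℝ) → ℝ} (hw : ContDiff ℝ 1 w) :
    Continuous (gradSq w) :=
  continuous_finsetSum _ fun _ _ =>
    ((hw.continuous_fderiv one_ne_zero).clm_apply continuous_const).pow 2

lemma integrable_gradSq {n : ℕ} {w : (Fin n → ℝ) → ℝ} (hw : ContDiff ℝ 1 w)
    (hs : HasCompactSupport w) : Integrable (gradSq w) := by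
  refine integrable_finsetSum _ fun i _ => ?_
  have hc : Continuous fun x => fderiv ℝ w x (Pi.single i 1) :=
    (hw.continuous_fderiv one_ne_zero).clm_apply continuous_const
  have hcs : HasCompactSupport fun x => fderiv ℝ w x (Pi.single i 1) := hs.fderiv_apply ℝ _
  have hcs2 : HasCompactSupport fun x => fderiv ℝ w x (Pi.single i 1) ^ 2 :=
    hcs.comp_left (g := fun t : ℝ => t ^ 2) (by simp)
  exact (hc.pow 2).integrable_of_hasCompactSupport hcs2

lemma gradSq_nonneg {n : ℕ} (w : (Fin n → ℝ) → ℝ) (x : Fin n → ℝ) : 0 ≤ gradSq w x :=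
  Finset.sum_nonneg fun _ _ => sq_nonneg _

lemma sum_abs_fderiv_abs_rpow_le {n : ℕ} {w : (Fin n → ℝ) → ℝ} (hw : ContDiff ℝ 1 w)
    {q : ℝ} (hq : 1 < q) (x y : Fin n → ℝ) :
    ∑ i, |fderiv ℝ (fun x => |w x| ^ q) x (Pi.single i 1)| * |y i| ≤
      q * (√(gradSq w x) * (|w x| ^ (q - 1) * √(∑ i, y i ^ 2))) := by
  have hd : ∀ v, fderiv ℝ (fun x => |w x| ^ q) x v =
      q * |w x| ^ (q - 2) * w x * fderiv ℝ w x v := fun v => by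
    have h := (hasDerivAt_abs_rpow (w x) hq).comp_hasFDerivAt x
      ((hw.differentiable one_ne_zero) x).hasFDerivAt
    have h2 : fderiv ℝ (fun x => |w x| ^ q) x = _ := h.fderiv
    rw [h2]
    simp
  have hab : |q * |w x| ^ (q - 2) * w x| = q * |w x| ^ (q - 1) := by
    rw [abs_mul, abs_mul, abs_of_pos (by linarith : (0 : ℝ) < q),
      abs_of_nonneg (Real.rpow_nonneg (abs_nonneg _) _), mul_assoc]
    congr 1
    rcases eq_or_ne (w x) 0 with h0 | h0
    · simp [h0, Real.zero_rpow (by linarith : q - 1 ≠ 0)]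
    · rw [← Real.rpow_add_one (abs_pos.2 h0).ne']
      ring_nf
  calc ∑ i, |fderiv ℝ (fun x => |w x| ^ q) x (Pi.single i 1)| * |y i|
      = q * |w x| ^ (q - 1) * ∑ i, |fderiv ℝ w x (Pi.single i 1)| * |y i| := by
        rw [Finset.mul_sum]
        refine Finset.sum_congr rfl fun i _ => ?_
        rw [hd, abs_mul, hab]
        ring
    _ ≤ q * |w x| ^ (q - 1) * (√(gradSq w x) * √(∑ i, y i ^ 2)) := by
        have := Real.sum_mul_le_sqrt_mul_sqrt Finset.univ
          (fun i => |fderiv ℝ w x (Pi.single i 1)|) (fun i => |y i|)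
        simp only [sq_abs] at this
        exact mul_le_mul_of_nonneg_left this (by positivity)
    _ = _ := by ring

lemma lintegral_ofReal_sqrt_mul_sqrt_le {α : Type*} [MeasurableSpace α] {μ : Measure α}
    {f g : α → ℝ} (hf : Measurable f) (hg : Measurable g) (hf0 : ∀ x, 0 ≤ f x)
    (hg0 : ∀ x, 0 ≤ g x) :
    ∫⁻ x, ENNReal.ofReal (√(f x) * √(g x)) ∂μ ≤
      (∫⁻ x, ENNReal.ofReal (f x) ∂μ) ^ (1 / 2 : ℝ) *
        (∫⁻ x, ENNReal.ofReal (g x) ∂μ) ^ (1 / 2 : ℝ) := by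
  have h := ENNReal.lintegral_mul_le_Lp_mul_Lq μ Real.HolderConjugate.two_two
    (f := fun x => ENNReal.ofReal √(f x)) (g := fun x => ENNReal.ofReal √(g x))
    hf.sqrt.ennreal_ofReal.aemeasurable hg.sqrt.ennreal_ofReal.aemeasurable
  have hsq : ∀ t : ℝ, 0 ≤ t → ENNReal.ofReal √t ^ (2 : ℝ) = ENNReal.ofReal t := fun t ht => by
    rw [ENNReal.ofReal_rpow_of_nonneg (Real.sqrt_nonneg _) (by norm_num)]
    norm_num [Real.sq_sqrt ht]
  simp only [hsq _ (hf0 _), hsq _ (hg0 _), Pi.mul_apply,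
    ← ENNReal.ofReal_mul (Real.sqrt_nonneg _)] at h
  exact h

lemma IsKnotheMap.sum_lintegral_mul_diag_le {n : ℕ} (hn : 3 ≤ n) {F G : (Fin n → ℝ) → ℝ}
    {T a : (Fin n → ℝ) → Fin n → ℝ} (hT : IsKnotheMap F G T a) (hG0 : ∀ y, 0 ≤ G y)
    (hGB : Integrable fun y => (∑ i, y i ^ 2) * G y)
    {w : (Fin n → ℝ) → ℝ} (hw : ContDiff ℝ 1 w) (hs : HasCompactSupport w) {Z : ℝ} (hZ : 0 ≤ Z)
    (hle : ∀ x, |w x| ^ twoStar n ≤ Z * F x) {q : ℝ} (hq : q = 2 * ((n : ℝ) - 1) / ((n : ℝ) - 2)) :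
    ∑ i, ∫⁻ x, ENNReal.ofReal (|w x| ^ q * a x i) ≤
      ENNReal.ofReal (q * (√(∫ x, gradSq w x) * √(Z * ∫ y, (∑ i, y i ^ 2) * G y))) := by
  have hn' : (3 : ℝ) ≤ n := by exact_mod_cast hn
  have hn2 : (0 : ℝ) < (n : ℝ) - 2 := by linarith
  have hq1 : 1 < q := by
    rw [hq, lt_div_iff₀ hn2]
    linarith
  have hpq : twoStar n = 2 * (q - 1) := by
    rw [hq, twoStar]
    field_simp
    ring
  have hwm := hw.continuous.measurable
  have hc1 : ContDiff ℝ 1 fun x => |w x| ^ q := (contDiff_norm_rpow hq1).comp hw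
  have hTm : ∀ i, Measurable fun x => T x i := fun i => (measurable_pi_apply i).comp hT.measurable
  have hTs : Measurable fun x => ∑ i, T x i ^ 2 :=
    Finset.measurable_sum _ fun i _ => (hTm i).pow_const 2
  have hdm : ∀ i, Measurable fun x => |fderiv ℝ (fun x => |w x| ^ q) x (Pi.single i 1)| * |T x i| :=
    fun i => (((hc1.continuous_fderiv one_ne_zero).clm_apply
      continuous_const).measurable.abs).mul (hTm i).abs
  have hsum0 : ∀ y : Fin n → ℝ, 0 ≤ ∑ i, y i ^ 2 := fun y =>
    Finset.sum_nonneg fun i _ => sq_nonneg _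
  calc ∑ i, ∫⁻ x, ENNReal.ofReal (|w x| ^ q * a x i)
      ≤ ∑ i, ∫⁻ x, ENNReal.ofReal
          (|fderiv ℝ (fun x => |w x| ^ q) x (Pi.single i 1)| * |T x i|) :=
        Finset.sum_le_sum fun i _ => hT.lintegral_mul_diag_le hc1
          (hasCompactSupport_abs_rpow hs (by linarith)) (fun x => by positivity) i
    _ = ∫⁻ x, ENNReal.ofReal
          (∑ i, |fderiv ℝ (fun x => |w x| ^ q) x (Pi.single i 1)| * |T x i|) := by
        rw [← lintegral_finsetSum _ fun i _ => (hdm i).ennreal_ofReal]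
        refine lintegral_congr fun x => ?_
        rw [ENNReal.ofReal_sum_of_nonneg fun i _ => by positivity]
    _ ≤ ∫⁻ x, ENNReal.ofReal q * ENNReal.ofReal
          (√(gradSq w x) * √(|w x| ^ twoStar n * ∑ i, T x i ^ 2)) := by
        refine lintegral_mono fun x => ?_
        rw [← ENNReal.ofReal_mul (by linarith)]
        refine ENNReal.ofReal_le_ofReal ((sum_abs_fderiv_abs_rpow_le hw hq1 x (T x)).trans_eq ?_)
        rw [Real.sqrt_mul (by positivity), hpq, mul_comm (2 : ℝ),
          Real.rpow_mul (abs_nonneg _), Real.rpow_two, Real.sqrt_sq (by positivity)]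
    _ ≤ ENNReal.ofReal q * ((∫⁻ x, ENNReal.ofReal (gradSq w x)) ^ (1 / 2 : ℝ) *
          (∫⁻ x, ENNReal.ofReal (|w x| ^ twoStar n * ∑ i, T x i ^ 2)) ^ (1 / 2 : ℝ)) := by
        rw [lintegral_const_mul' _ _ ENNReal.ofReal_ne_top]
        gcongr
        exact lintegral_ofReal_sqrt_mul_sqrt_le (continuous_gradSq hw).measurable
          ((hwm.abs.pow_const _).mul hTs) (gradSq_nonneg w)
          fun x => mul_nonneg (by positivity) (hsum0 _)
    _ ≤ ENNReal.ofReal q * (ENNReal.ofReal (∫ x, gradSq w x) ^ (1 / 2 : ℝ) *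
          ENNReal.ofReal (Z * ∫ y, (∑ i, y i ^ 2) * G y) ^ (1 / 2 : ℝ)) := by
        rw [← ofReal_integral_eq_lintegral_ofReal (integrable_gradSq hw hs)
          (.of_forall (gradSq_nonneg w))]
        gcongr
        calc ∫⁻ x, ENNReal.ofReal (|w x| ^ twoStar n * ∑ i, T x i ^ 2)
            ≤ ∫⁻ x, ENNReal.ofReal Z *
                (ENNReal.ofReal (∑ i, T x i ^ 2) * ENNReal.ofReal (F x)) := by
              refine lintegral_mono fun x => ?_
              rw [← ENNReal.ofReal_mul (hsum0 _), ← ENNReal.ofReal_mul hZ]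
              refine ENNReal.ofReal_le_ofReal ?_
              have := mul_le_mul_of_nonneg_right (hle x) (hsum0 (T x))
              linarith
          _ = ENNReal.ofReal Z * ∫⁻ y, ENNReal.ofReal (∑ i, y i ^ 2) * ENNReal.ofReal (G y) := by
              rw [lintegral_const_mul' _ _ ENNReal.ofReal_ne_top, hT.lintegral_comp
                (fun y => ENNReal.ofReal (∑ i, y i ^ 2)) (by fun_prop)]
          _ = ENNReal.ofReal (Z * ∫ y, (∑ i, y i ^ 2) * G y) := by
              rw [ENNReal.ofReal_mul hZ, ofReal_integral_eq_lintegral_ofReal hGB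
                (.of_forall fun y => mul_nonneg (hsum0 y) (hG0 y))]
              simp only [ENNReal.ofReal_mul (hsum0 _)]
    _ = _ := by
        rw [ENNReal.ofReal_mul (p := q) (by linarith), ENNReal.ofReal_mul (Real.sqrt_nonneg _),
          Real.sqrt_eq_rpow, Real.sqrt_eq_rpow,
          ENNReal.ofReal_rpow_of_nonneg (integral_nonneg (gradSq_nonneg w)) (by norm_num),
          ENNReal.ofReal_rpow_of_nonneg (mul_nonneg hZ (integral_nonneg fun y =>
            mul_nonneg (hsum0 y) (hG0 y))) (by norm_num)]

lemma IsTransportDensity.add_of_hasCompactSupport {n : ℕ} {f G : (Fin n → ℝ) → ℝ}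
    (hf : Continuous f) (hs : HasCompactSupport f) (h0 : ∀ x, 0 ≤ f x)
    (hG : IsTransportDensity G) {δ Z : ℝ} (hδ : 0 < δ) (hZ : 0 < Z) :
    IsTransportDensity fun x => (f x + δ * G x) / Z := by
  have hprod : Continuous fun x : Fin n → ℝ => ∏ i, (1 + x i ^ 2) := by fun_prop
  obtain ⟨C₁, hC₁⟩ := (hf.mul hprod).bounded_above_of_compact_support hs.mul_right
  obtain ⟨C₂, hC₂⟩ := hG.bound
  refine ⟨(hf.add (continuous_const.mul hG.continuous)).div_const _, fun x => ?_,
    ⟨(C₁ + δ * C₂) / Z, fun x => ?_⟩⟩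
  · exact div_pos (add_pos_of_nonneg_of_pos (h0 x) (mul_pos hδ (hG.pos x))) hZ
  · have hp : 0 < ∏ i, (1 + x i ^ 2) := Finset.prod_pos fun i _ => by positivity
    have h1 : f x ≤ C₁ * ∏ i, (1 + x i ^ 2)⁻¹ := by
      rw [Finset.prod_inv_distrib, ← div_eq_mul_inv, le_div_iff₀ hp]
      exact (le_abs_self _).trans (hC₁ x)
    have h2 := mul_le_mul_of_nonneg_left (hC₂ x) hδ.le
    rw [div_mul_eq_mul_div, div_le_div_iff_of_pos_right hZ]
    linarith

lemma rpow_le_geom_mean_bound {n : ℕ} (hn : 3 ≤ n) {t Z g : ℝ} (hZ : 0 ≤ Z) (hg : 0 < g)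
    {a : Fin n → ℝ} (ha : ∀ i, 0 ≤ a i) (hle : |t| ^ twoStar n ≤ Z * (g * ∏ i, a i)) {q : ℝ}
    (hq : q = 2 * ((n : ℝ) - 1) / ((n : ℝ) - 2)) :
    g ^ (-(1 / (n : ℝ))) * |t| ^ twoStar n ≤
      Z ^ (1 / (n : ℝ)) / n * ∑ i, |t| ^ q * a i := by
  have hn' : (3 : ℝ) ≤ n := by exact_mod_cast hn
  have hn2 : (0 : ℝ) < (n : ℝ) - 2 := by linarith
  have hq0 : 0 < q := by
    rw [hq]
    exact div_pos (by linarith) hn2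
  have hp0 : 0 < twoStar n := div_pos (by linarith) hn2
  have hsplit : |t| ^ twoStar n = |t| ^ q * (|t| ^ twoStar n) ^ (1 / (n : ℝ)) := by
    rw [← Real.rpow_mul (abs_nonneg _), ← Real.rpow_add_of_nonneg (abs_nonneg _) hq0.le
      (by positivity)]
    congr 1
    rw [hq, twoStar]
    field_simp
    ring
  have hprod : 0 ≤ ∏ i, a i := Finset.prod_nonneg fun i _ => ha i
  have hamgm : (∏ i, a i) ^ (1 / (n : ℝ)) ≤ (1 / (n : ℝ)) * ∑ i, a i := by
    have h := Real.geom_mean_le_arith_mean_weighted Finset.univ (fun _ : Fin n => 1 / (n : ℝ)) a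
      (fun _ _ => by positivity) (by simp; field_simp) (fun i _ => ha i)
    rwa [Real.finsetProd_rpow _ _ fun i _ => ha i, ← Finset.mul_sum] at h
  calc g ^ (-(1 / (n : ℝ))) * |t| ^ twoStar n
      ≤ g ^ (-(1 / (n : ℝ))) * (|t| ^ q * (Z * (g * ∏ i, a i)) ^ (1 / (n : ℝ))) := by
        rw [hsplit]
        gcongr
    _ = Z ^ (1 / (n : ℝ)) * |t| ^ q * (∏ i, a i) ^ (1 / (n : ℝ)) := by
        rw [Real.mul_rpow hZ (by positivity), Real.mul_rpow hg.le hprod, Real.rpow_neg hg.le]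
        have : g ^ (1 / (n : ℝ)) ≠ 0 := (Real.rpow_pos_of_pos hg _).ne'
        field_simp
    _ ≤ Z ^ (1 / (n : ℝ)) * |t| ^ q * ((1 / (n : ℝ)) * ∑ i, a i) := by gcongr
    _ = _ := by
        rw [← Finset.mul_sum]
        ring

/-- The transport inequality with a truncated target and a perturbed source. -/
lemma transport_inequality_aux {n : ℕ} (hn : 3 ≤ n) {G : (Fin n → ℝ) → ℝ}
    (hG : IsTransportDensity G) (hG1 : ∫ y, G y = 1)
    (hGB : Integrable fun y => (∑ i, y i ^ 2) * G y)
    {w : (Fin n → ℝ) → ℝ} (hw : ContDiff ℝ 1 w) (hs : HasCompactSupport w)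
    {q δ M : ℝ} (hq : q = 2 * ((n : ℝ) - 1) / ((n : ℝ) - 2)) (hδ : 0 < δ) (hM : 0 ≤ M) {Z : ℝ}
    (hZ : Z = (∫ x, |w x| ^ twoStar n) + δ) :
    Z * ∫ y, min (G y ^ (-(1 / (n : ℝ)))) M * G y ≤
      Z ^ (1 / (n : ℝ)) / n *
        (q * (√(∫ x, gradSq w x) * √(Z * ∫ y, (∑ i, y i ^ 2) * G y))) + δ * M := by
  have hn' : (3 : ℝ) ≤ n := by exact_mod_cast hn
  have hn2 : (0 : ℝ) < (n : ℝ) - 2 := by linarith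
  have hp0 : 0 < twoStar n := div_pos (by linarith) hn2
  have hq0 : 0 < q := by
    rw [hq]
    exact div_pos (by linarith) hn2
  have hwc : Continuous fun x => |w x| ^ twoStar n :=
    hw.continuous.abs.rpow_const fun _ => Or.inr hp0.le
  have hwcs := hasCompactSupport_abs_rpow hs hp0
  have hw0 : ∀ x, 0 ≤ |w x| ^ twoStar n := fun x => by positivity
  have hZ0 : 0 < Z := hZ ▸ add_pos_of_nonneg_of_pos (integral_nonneg hw0) hδ
  have hwi : Integrable fun x => |w x| ^ twoStar n := hwc.integrable_of_hasCompactSupport hwcs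
  set F : (Fin n → ℝ) → ℝ := fun x => (|w x| ^ twoStar n + δ * G x) / Z with hFdef
  have hF : IsTransportDensity F := .add_of_hasCompactSupport hwc hwcs hw0 hG hδ hZ0
  have hZF : ∀ x, Z * F x = |w x| ^ twoStar n + δ * G x := fun x => by
    simp only [hFdef]
    field_simp
  have hF1 : ∫ x, F x = 1 := by
    simp only [hFdef]
    rw [integral_div, integral_add hwi (hG.integrable.const_mul δ), integral_const_mul, hG1,
      mul_one, ← hZ, div_self hZ0.ne']
  obtain ⟨T, a, hT⟩ := exists_isKnotheMap hF hG (hF1.trans hG1.symm)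
  have hle : ∀ x, |w x| ^ twoStar n ≤ Z * F x := fun x => by
    rw [hZF]
    exact le_add_of_nonneg_right (mul_pos hδ (hG.pos x)).le
  set κ : (Fin n → ℝ) → ℝ := fun y => min (G y ^ (-(1 / (n : ℝ)))) M with hκ
  have hκ0 : ∀ y, 0 ≤ κ y := fun y => le_min (Real.rpow_nonneg (hG.pos y).le _) hM
  have hκm : Measurable κ := (hG.continuous.measurable.pow_const _).min measurable_const
  have hκi : Integrable fun y => κ y * G y := by
    refine (hG.integrable.const_mul M).mono' (hκm.mul hG.continuous.measurable).aestronglyMeasurable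
      (.of_forall fun y => ?_)
    rw [Real.norm_of_nonneg (mul_nonneg (hκ0 y) (hG.pos y).le)]
    exact mul_le_mul_of_nonneg_right (min_le_right _ _) (hG.pos y).le
  have hpt : ∀ x, Z * (κ (T x) * F x) ≤
      Z ^ (1 / (n : ℝ)) / n * ∑ i, |w x| ^ q * a x i + δ * M * G x := fun x => by
    have h1 := rpow_le_geom_mean_bound hn hZ0.le (hG.pos (T x)) (fun i => (hT.diag_pos x i).le)
      (by rw [hT.jacobian]; exact hle x) hq
    have h2 : κ (T x) * |w x| ^ twoStar n ≤ G (T x) ^ (-(1 / (n : ℝ))) * |w x| ^ twoStar n :=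
      mul_le_mul_of_nonneg_right (min_le_left _ _) (hw0 x)
    have h3 : κ (T x) * (δ * G x) ≤ M * (δ * G x) :=
      mul_le_mul_of_nonneg_right (min_le_right _ _) (mul_pos hδ (hG.pos x)).le
    calc Z * (κ (T x) * F x) = κ (T x) * |w x| ^ twoStar n + κ (T x) * (δ * G x) := by
          rw [mul_left_comm, hZF]
          ring
      _ ≤ _ := by linarith
  have ham : ∀ i, Measurable fun x => |w x| ^ q * a x i := fun i =>
    (hw.continuous.measurable.abs.pow_const _).mul
      ((measurable_pi_apply i).comp hT.measurable_diag)
  have hB0 : 0 ≤ ∫ y, (∑ i, y i ^ 2) * G y := integral_nonneg fun y =>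
    mul_nonneg (Finset.sum_nonneg fun i _ => sq_nonneg _) (hG.pos y).le
  have key : ENNReal.ofReal (Z * ∫ y, κ y * G y) ≤
      ENNReal.ofReal (Z ^ (1 / (n : ℝ)) / n *
        (q * (√(∫ x, gradSq w x) * √(Z * ∫ y, (∑ i, y i ^ 2) * G y))) + δ * M) := by
    calc ENNReal.ofReal (Z * ∫ y, κ y * G y)
        = ENNReal.ofReal Z * ∫⁻ y, ENNReal.ofReal (κ y) * ENNReal.ofReal (G y) := by
          rw [ENNReal.ofReal_mul hZ0.le, ofReal_integral_eq_lintegral_ofReal hκi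
            (.of_forall fun y => mul_nonneg (hκ0 y) (hG.pos y).le)]
          simp only [ENNReal.ofReal_mul (hκ0 _)]
      _ = ∫⁻ x, ENNReal.ofReal (Z * (κ (T x) * F x)) := by
          rw [← hT.lintegral_comp (fun y => ENNReal.ofReal (κ y)) hκm.ennreal_ofReal,
            ← lintegral_const_mul' _ _ ENNReal.ofReal_ne_top]
          simp only [ENNReal.ofReal_mul hZ0.le, ENNReal.ofReal_mul (hκ0 _)]
      _ ≤ ∫⁻ x, (ENNReal.ofReal (Z ^ (1 / (n : ℝ)) / n) *
            (∑ i, ENNReal.ofReal (|w x| ^ q * a x i)) + ENNReal.ofReal (δ * M * G x)) := by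
          refine lintegral_mono fun x => ?_
          have h0 : ∀ i ∈ Finset.univ, 0 ≤ |w x| ^ q * a x i := fun i _ =>
            mul_nonneg (by positivity) (hT.diag_pos x i).le
          rw [← ENNReal.ofReal_sum_of_nonneg h0, ← ENNReal.ofReal_mul (by positivity),
            ← ENNReal.ofReal_add (mul_nonneg (by positivity) (Finset.sum_nonneg h0))
              (mul_nonneg (by positivity) (hG.pos x).le)]
          exact ENNReal.ofReal_le_ofReal (hpt x)
      _ = ENNReal.ofReal (Z ^ (1 / (n : ℝ)) / n) *
            (∑ i, ∫⁻ x, ENNReal.ofReal (|w x| ^ q * a x i)) + ENNReal.ofReal (δ * M) := by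
          rw [lintegral_add_right _ (hG.continuous.measurable.const_mul _).ennreal_ofReal,
            lintegral_const_mul' _ _ ENNReal.ofReal_ne_top,
            lintegral_finsetSum _ fun i _ => (ham i).ennreal_ofReal,
            ← ofReal_integral_eq_lintegral_ofReal (hG.integrable.const_mul (δ * M))
              (.of_forall fun y => mul_nonneg (by positivity) (hG.pos y).le),
            integral_const_mul, hG1, mul_one]
      _ ≤ ENNReal.ofReal (Z ^ (1 / (n : ℝ)) / n) * ENNReal.ofReal
            (q * (√(∫ x, gradSq w x) * √(Z * ∫ y, (∑ i, y i ^ 2) * G y))) +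
            ENNReal.ofReal (δ * M) := by
          gcongr
          exact hT.sum_lintegral_mul_diag_le hn (fun y => (hG.pos y).le) hGB hw hs hZ0.le hle hq
      _ = _ := by
          rw [← ENNReal.ofReal_mul (by positivity), ← ENNReal.ofReal_add (by positivity)
            (by positivity)]
  exact (ENNReal.ofReal_le_ofReal_iff (by positivity)).1 key

/-- The mass transport form of the sharp Sobolev inequality, tested against a probability
density `G`. -/
theorem sobolev_of_transportDensity {n : ℕ} (hn : 3 ≤ n) {G : (Fin n → ℝ) → ℝ}
    (hG : IsTransportDensity G) (hG1 : ∫ y, G y = 1)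
    (hGB : Integrable fun y => (∑ i, y i ^ 2) * G y)
    (hGA : Integrable fun y => G y ^ (-(1 / (n : ℝ))) * G y)
    {w : (Fin n → ℝ) → ℝ} (hw : ContDiff ℝ 1 w) (hs : HasCompactSupport w)
    {q m : ℝ} (hq : q = 2 * ((n : ℝ) - 1) / ((n : ℝ) - 2)) (hm : m = ∫ x, |w x| ^ twoStar n) :
    m * ∫ y, G y ^ (-(1 / (n : ℝ))) * G y ≤
      m ^ (1 / (n : ℝ)) / n *
        (q * (√(∫ x, gradSq w x) * √(m * ∫ y, (∑ i, y i ^ 2) * G y))) := by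
  have hstep : ∀ M : ℝ, 0 ≤ M → m * ∫ y, min (G y ^ (-(1 / (n : ℝ)))) M * G y ≤
      m ^ (1 / (n : ℝ)) / n *
        (q * (√(∫ x, gradSq w x) * √(m * ∫ y, (∑ i, y i ^ 2) * G y))) := by
    intro M hM
    set A := ∫ y, min (G y ^ (-(1 / (n : ℝ)))) M * G y
    set B := ∫ y, (∑ i, y i ^ 2) * G y
    have hexp : (0 : ℝ) ≤ 1 / n := by positivity
    have hL : Continuous fun δ : ℝ => (m + δ) * A := by fun_prop
    have hR : Continuous fun δ : ℝ => (m + δ) ^ (1 / (n : ℝ)) / n *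
        (q * (√(∫ x, gradSq w x) * √((m + δ) * B))) + δ * M := by
      have : Continuous fun δ : ℝ => (m + δ) ^ (1 / (n : ℝ)) :=
        (continuous_const.add continuous_id).rpow_const fun _ => Or.inr hexp
      fun_prop
    have hl := (hL.tendsto 0).mono_left (nhdsWithin_le_nhds (s := Set.Ioi 0))
    have hr := (hR.tendsto 0).mono_left (nhdsWithin_le_nhds (s := Set.Ioi 0))
    have := le_of_tendsto_of_tendsto hl hr (by
      filter_upwards [self_mem_nhdsWithin] with δ hδ
      exact transport_inequality_aux hn hG hG1 hGB hw hs hq hδ hM (by rw [hm]))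
    simpa using this
  have hlim : Filter.Tendsto (fun k : ℕ => ∫ y, min (G y ^ (-(1 / (n : ℝ)))) (k : ℝ) * G y)
      Filter.atTop (nhds (∫ y, G y ^ (-(1 / (n : ℝ))) * G y)) := by
    refine tendsto_integral_of_dominated_convergence _ (fun k => ?_) hGA (fun k => ?_) ?_
    · exact (((hG.continuous.measurable.pow_const _).min measurable_const).mul
        hG.continuous.measurable).aestronglyMeasurable
    · refine .of_forall fun y => ?_
      have h0 := hG.pos y
      rw [Real.norm_of_nonneg (by positivity)]
      exact mul_le_mul_of_nonneg_right (min_le_left _ _) h0.le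
    · refine .of_forall fun y => tendsto_const_nhds.congr' ?_
      filter_upwards [Filter.eventually_ge_atTop ⌈G y ^ (-(1 / (n : ℝ)))⌉₊] with k hk
      rw [min_eq_left (Nat.ceil_le.1 hk)]
  exact le_of_tendsto (hlim.const_mul m) (.of_forall fun k => hstep k k.cast_nonneg)

/-! ### The Sobolev constant and the Aubin–Talenti bubble -/

section Bubble

variable {N : ℕ}

/-- The integral `∫ (1 + |y|²)^{-N}`. -/
def bubbleMass (N : ℕ) : ℝ := ∫ y : Euc N, (1 + ‖y‖ ^ 2) ^ (-(N : ℝ))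

/-- The integral `∫ |y|² (1 + |y|²)^{-N}`. -/
def bubbleMoment (N : ℕ) : ℝ := ∫ y : Euc N, ‖y‖ ^ 2 * (1 + ‖y‖ ^ 2) ^ (-(N : ℝ))

lemma integrable_one_add_norm_sq_rpow {s : ℝ} (hs : (N : ℝ) < 2 * s) :
    Integrable fun y : Euc N => (1 + ‖y‖ ^ 2) ^ (-s) := by
  have h := integrable_rpow_neg_one_add_norm_sq (E := Euc N) (μ := volume) (r := 2 * s)
    (by simpa using hs)
  have e : -(2 * s) / 2 = -s := by ring
  rwa [e] at h

lemma integrable_mul_one_add_norm_sq_rpow {f : Euc N → ℝ} (hf : Continuous f) {s t : ℝ}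
    (hle : ∀ y, |f y| ≤ (1 + ‖y‖ ^ 2) ^ t) (hs : (N : ℝ) < 2 * (s - t)) :
    Integrable fun y : Euc N => f y * (1 + ‖y‖ ^ 2) ^ (-s) := by
  have hc : Continuous fun y : Euc N => (1 + ‖y‖ ^ 2) ^ (-s) :=
    Continuous.rpow_const (by fun_prop) fun y => Or.inl (by positivity)
  refine (integrable_one_add_norm_sq_rpow hs).mono' (hf.mul hc).aestronglyMeasurable
    (.of_forall fun y => ?_)
  have hp : 0 < 1 + ‖y‖ ^ 2 := by positivity
  rw [norm_mul, Real.norm_eq_abs, Real.norm_of_nonneg (by positivity),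
    show -(s - t) = t + -s by ring, Real.rpow_add hp]
  exact mul_le_mul_of_nonneg_right (hle y) (by positivity)

lemma integrable_norm_sq_mul_bubble (hN : 4 ≤ N) :
    Integrable fun y : Euc N => ‖y‖ ^ 2 * (1 + ‖y‖ ^ 2) ^ (-(N : ℝ)) := by
  have hN' : (4 : ℝ) ≤ N := by exact_mod_cast hN
  refine integrable_mul_one_add_norm_sq_rpow (t := 1) (by fun_prop) (fun y => ?_) (by linarith)
  rw [abs_of_nonneg (by positivity), Real.rpow_one]
  linarith

lemma integrable_bubble (hN : 4 ≤ N) :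
    Integrable fun y : Euc N => (1 + ‖y‖ ^ 2) ^ (-(N : ℝ)) := by
  have hN' : (4 : ℝ) ≤ N := by exact_mod_cast hN
  exact integrable_one_add_norm_sq_rpow (by linarith)

lemma bubbleMass_pos (hN : 4 ≤ N) : 0 < bubbleMass N := by
  refine integral_pos_of_integrable_nonneg_nonzero (x := 0) ?_ (integrable_bubble hN)
    (fun y => by positivity) (by simp)
  exact Continuous.rpow_const (by fun_prop) fun y => Or.inl (by positivity)

lemma hasFDerivAt_add_norm_sq_rpow {c : ℝ} (hc : 0 < c) (s : ℝ) (x : Euc N) :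
    HasFDerivAt (fun y : Euc N => (c + ‖y‖ ^ 2) ^ s)
      ((s * (c + ‖x‖ ^ 2) ^ (s - 1)) • ((2 : ℝ) • innerSL ℝ x)) x := by
  have h := ((hasStrictFDerivAt_norm_sq x).hasFDerivAt.const_add c).rpow_const (p := s)
    (Or.inl (by positivity))
  rw [ofNat_smul_eq_nsmul ℝ 2 (innerSL ℝ x)]
  exact h

/-- The virial identity for the bubble. -/
lemma integral_bubble_virial (hN : 4 ≤ N) :
    (N : ℝ) * ∫ y : Euc N, (1 + ‖y‖ ^ 2) ^ (-((N : ℝ) - 1)) =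
      2 * ((N : ℝ) - 1) * bubbleMoment N := by
  have hN' : (4 : ℝ) ≤ N := by exact_mod_cast hN
  have hd : ∀ (i : Fin N) (y : Euc N),
      fderiv ℝ (fun y : Euc N => (1 + ‖y‖ ^ 2) ^ (-((N : ℝ) - 1))) y (EuclideanSpace.single i 1) =
        -(2 * ((N : ℝ) - 1)) * (y i * (1 + ‖y‖ ^ 2) ^ (-(N : ℝ))) := fun i y => by
    rw [(hasFDerivAt_add_norm_sq_rpow one_pos _ y).fderiv,
      show -((N : ℝ) - 1) - 1 = -(N : ℝ) by ring]
    simp [EuclideanSpace.inner_single_right]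
    ring
  have hf : ∀ (i : Fin N) (y : Euc N),
      fderiv ℝ (fun y : Euc N => y i) y (EuclideanSpace.single i 1) = 1 := fun i y => by
    have : fderiv ℝ (fun y : Euc N => y i) y = EuclideanSpace.proj i :=
      (EuclideanSpace.proj (𝕜 := ℝ) i).fderiv
    rw [this]
    simp
  have habs : ∀ (i : Fin N) (y : Euc N), |y i| ≤ ‖y‖ := fun i y => PiLp.norm_apply_le y i
  have hi1 : ∀ i : Fin N, Integrable fun y : Euc N => y i ^ 2 * (1 + ‖y‖ ^ 2) ^ (-(N : ℝ)) := by
    intro i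
    refine integrable_mul_one_add_norm_sq_rpow (t := 1) (by fun_prop) (fun y => ?_) (by linarith)
    rw [abs_pow, Real.rpow_one]
    nlinarith [habs i y, abs_nonneg (y i)]
  have hi2 : ∀ i : Fin N,
      Integrable fun y : Euc N => y i * (1 + ‖y‖ ^ 2) ^ (-((N : ℝ) - 1)) := by
    intro i
    refine integrable_mul_one_add_norm_sq_rpow (t := 1 / 2) (by fun_prop) (fun y => ?_)
      (by linarith)
    rw [← Real.sqrt_eq_rpow]
    exact Real.le_sqrt_of_sq_le (by nlinarith [habs i y, abs_nonneg (y i)])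
  have hparts : ∀ i : Fin N, ∫ y : Euc N, (1 + ‖y‖ ^ 2) ^ (-((N : ℝ) - 1)) =
      2 * ((N : ℝ) - 1) * ∫ y : Euc N, y i ^ 2 * (1 + ‖y‖ ^ 2) ^ (-(N : ℝ)) := by
    intro i
    have h := integral_mul_fderiv_eq_neg_fderiv_mul_of_integrable (μ := (volume : Measure (Euc N)))
      (f := fun y : Euc N => y i) (g := fun y : Euc N => (1 + ‖y‖ ^ 2) ^ (-((N : ℝ) - 1)))
      (v := EuclideanSpace.single i 1)
      (by
        simp only [hf, one_mul]
        exact integrable_one_add_norm_sq_rpow (by linarith))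
      (by
        simp only [hd]
        refine ((hi1 i).const_mul (-(2 * ((N : ℝ) - 1)))).congr (.of_forall fun y => ?_)
        ring)
      (hi2 i) (fun y _ => (EuclideanSpace.proj (𝕜 := ℝ) i).differentiableAt)
      (fun y _ => (hasFDerivAt_add_norm_sq_rpow one_pos _ y).differentiableAt)
    simp only [hf, hd, one_mul] at h
    have e : ∀ y : Euc N, y i * (-(2 * ((N : ℝ) - 1)) * (y i * (1 + ‖y‖ ^ 2) ^ (-(N : ℝ)))) =
        -(2 * ((N : ℝ) - 1)) * (y i ^ 2 * (1 + ‖y‖ ^ 2) ^ (-(N : ℝ))) := fun y => by ring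
    simp only [e, integral_const_mul] at h
    linarith
  have hsum : bubbleMoment N = ∑ i : Fin N, ∫ y : Euc N, y i ^ 2 * (1 + ‖y‖ ^ 2) ^ (-(N : ℝ)) := by
    rw [← integral_finsetSum _ fun i _ => hi1 i, bubbleMoment]
    refine integral_congr_ae (.of_forall fun y => ?_)
    simp only
    rw [← Finset.sum_mul, ← EuclideanSpace.real_norm_sq_eq]
  rw [hsum, Finset.mul_sum, ← Finset.sum_congr rfl fun i _ => hparts i]
  simp

lemma integral_comp_toLp (f : Euc N → ℝ) :
    ∫ x : Fin N → ℝ, f (WithLp.toLp 2 x) = ∫ y, f y :=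
  (PiLp.volume_preserving_toLp (Fin N)).integral_comp
    (MeasurableEquiv.toLp 2 (Fin N → ℝ)).measurableEmbedding f

lemma integrable_comp_toLp {f : Euc N → ℝ} (hf : Integrable f) :
    Integrable fun x : Fin N → ℝ => f (WithLp.toLp 2 x) :=
  (PiLp.volume_preserving_toLp (Fin N)).integrable_comp_of_integrable hf

lemma norm_sq_toLp (x : Fin N → ℝ) : ‖(WithLp.toLp 2 x : Euc N)‖ ^ 2 = ∑ i, x i ^ 2 :=
  EuclideanSpace.real_norm_sq_eq _

lemma isTransportDensity_bubble (hN : 4 ≤ N) :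
    IsTransportDensity fun x : Fin N → ℝ =>
      (bubbleMass N)⁻¹ * (1 + ‖(WithLp.toLp 2 x : Euc N)‖ ^ 2) ^ (-(N : ℝ)) := by
  have hK := bubbleMass_pos hN
  refine ⟨?_, fun x => by positivity, ⟨(bubbleMass N)⁻¹, fun x => ?_⟩⟩
  · refine continuous_const.mul (Continuous.rpow_const ?_ fun y => Or.inl (by positivity))
    exact continuous_const.add ((PiLp.continuous_toLp 2 _).norm.pow 2)
  · have h : ∏ i, (1 + x i ^ 2) ≤ (1 + ‖(WithLp.toLp 2 x : Euc N)‖ ^ 2) ^ N := by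
      calc ∏ i, (1 + x i ^ 2) ≤ ∏ _i : Fin N, (1 + ‖(WithLp.toLp 2 x : Euc N)‖ ^ 2) := by
            refine Finset.prod_le_prod (fun i _ => by positivity) fun i _ => ?_
            rw [norm_sq_toLp]
            gcongr
            exact Finset.single_le_sum (f := fun i => x i ^ 2) (fun j _ => sq_nonneg _)
              (Finset.mem_univ i)
        _ = _ := by simp
    rw [Real.rpow_neg (by positivity), Real.rpow_natCast, Finset.prod_inv_distrib]
    have hp : 0 < ∏ i, (1 + x i ^ 2) := Finset.prod_pos fun i _ => by positivity
    gcongr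

lemma norm_gradient_sq_eq_gradSq {v : Euc N → ℝ} (hv : Differentiable ℝ v) (x : Fin N → ℝ) :
    gradSq (fun x : Fin N → ℝ => v (WithLp.toLp 2 x)) x = ‖gradient v (WithLp.toLp 2 x)‖ ^ 2 := by
  rw [EuclideanSpace.real_norm_sq_eq, gradSq]
  refine Finset.sum_congr rfl fun i _ => ?_
  congr 1
  have h1 : HasFDerivAt (fun x : Fin N → ℝ => (WithLp.toLp 2 x : Euc N))
      ((PiLp.continuousLinearEquiv 2 ℝ fun _ : Fin N => ℝ).symm : (Fin N → ℝ) →L[ℝ] Euc N) x :=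
    ((PiLp.continuousLinearEquiv 2 ℝ fun _ : Fin N => ℝ).symm :
      (Fin N → ℝ) →L[ℝ] Euc N).hasFDerivAt
  have h2 : fderiv ℝ (fun x : Fin N → ℝ => v (WithLp.toLp 2 x)) x = _ :=
    ((hv (WithLp.toLp 2 x)).hasFDerivAt.comp x h1).fderiv
  have h3 : inner ℝ (gradient v (WithLp.toLp 2 x)) (EuclideanSpace.single i (1 : ℝ)) =
      fderiv ℝ v (WithLp.toLp 2 x) (EuclideanSpace.single i 1) := by
    rw [gradient, InnerProductSpace.toDual_symm_apply]
  rw [h2]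
  rw [EuclideanSpace.inner_single_right] at h3
  simp at h3
  rw [h3]
  rfl

lemma mul_rpow_le_integral_norm_gradient_sq (hN : 4 ≤ N) {v : Euc N → ℝ} (hv : ContDiff ℝ 1 v)
    (hs : HasCompactSupport v) (hm : 0 < ∫ x, |v x| ^ twoStar N) :
    ((N : ℝ) - 2) ^ 2 * bubbleMoment N / bubbleMass N ^ (2 / twoStar N) *
      (∫ x, |v x| ^ twoStar N) ^ (2 / twoStar N) ≤ ∫ x, ‖gradient v x‖ ^ 2 := by
  have hN' : (4 : ℝ) ≤ N := by exact_mod_cast hN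
  have hK := bubbleMass_pos hN
  have hw : ContDiff ℝ 1 fun x : Fin N → ℝ => v (WithLp.toLp 2 x) :=
    hv.comp (PiLp.continuousLinearEquiv 2 ℝ fun _ : Fin N => ℝ).symm.contDiff
  have hws : HasCompactSupport fun x : Fin N → ℝ => v (WithLp.toLp 2 x) :=
    hs.comp_homeomorph (PiLp.continuousLinearEquiv 2 ℝ fun _ : Fin N => ℝ).symm.toHomeomorph
  set K := bubbleMass N with hKdef
  set B := bubbleMoment N with hBdef
  set m := ∫ x, |v x| ^ twoStar N with hmdef
  set X := ∫ x, ‖gradient v x‖ ^ 2 with hXdef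
  have hA : ∀ y : Euc N, (K⁻¹ * (1 + ‖y‖ ^ 2) ^ (-(N : ℝ))) ^ (-(1 / (N : ℝ))) *
      (K⁻¹ * (1 + ‖y‖ ^ 2) ^ (-(N : ℝ))) =
      K ^ (1 / (N : ℝ)) / K * (1 + ‖y‖ ^ 2) ^ (-((N : ℝ) - 1)) := fun y => by
    have hy : 0 < 1 + ‖y‖ ^ 2 := by positivity
    rw [Real.mul_rpow (by positivity) (by positivity), ← Real.rpow_mul hy.le,
      Real.inv_rpow hK.le, Real.rpow_neg hK.le, inv_inv,
      show -(N : ℝ) * -(1 / (N : ℝ)) = 1 by field_simp,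
      show -((N : ℝ) - 1) = 1 + -(N : ℝ) by ring, Real.rpow_add hy]
    ring
  have hBi : ∀ y : Euc N, ‖y‖ ^ 2 * (K⁻¹ * (1 + ‖y‖ ^ 2) ^ (-(N : ℝ))) =
      K⁻¹ * (‖y‖ ^ 2 * (1 + ‖y‖ ^ 2) ^ (-(N : ℝ))) := fun y => by ring
  have h := sobolev_of_transportDensity (by omega) (isTransportDensity_bubble hN)
    (by
      rw [integral_comp_toLp fun y : Euc N => (bubbleMass N)⁻¹ * (1 + ‖y‖ ^ 2) ^ (-(N : ℝ)),
        integral_const_mul]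
      exact inv_mul_cancel₀ hK.ne')
    (by
      simp only [← norm_sq_toLp]
      refine integrable_comp_toLp
        (f := fun y : Euc N => ‖y‖ ^ 2 * (K⁻¹ * (1 + ‖y‖ ^ 2) ^ (-(N : ℝ)))) ?_
      simp only [hBi]
      exact (integrable_norm_sq_mul_bubble hN).const_mul _)
    (by
      refine integrable_comp_toLp (f := fun y : Euc N =>
        (K⁻¹ * (1 + ‖y‖ ^ 2) ^ (-(N : ℝ))) ^ (-(1 / (N : ℝ))) *
          (K⁻¹ * (1 + ‖y‖ ^ 2) ^ (-(N : ℝ)))) ?_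
      simp only [hA]
      exact (integrable_one_add_norm_sq_rpow (by linarith)).const_mul _)
    hw hws rfl rfl
  simp only [← norm_sq_toLp, norm_gradient_sq_eq_gradSq (hv.differentiable one_ne_zero)] at h
  rw [integral_comp_toLp fun y : Euc N => |v y| ^ twoStar N,
    integral_comp_toLp fun y : Euc N => ‖gradient v y‖ ^ 2,
    integral_comp_toLp fun y : Euc N => ‖y‖ ^ 2 * (K⁻¹ * (1 + ‖y‖ ^ 2) ^ (-(N : ℝ))),
    integral_comp_toLp fun y : Euc N => (K⁻¹ * (1 + ‖y‖ ^ 2) ^ (-(N : ℝ))) ^ (-(1 / (N : ℝ))) *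
          (K⁻¹ * (1 + ‖y‖ ^ 2) ^ (-(N : ℝ)))] at h
  simp only [hA, hBi, integral_const_mul] at h
  have hvir := integral_bubble_virial hN
  have hA0 : ∫ y : Euc N, (1 + ‖y‖ ^ 2) ^ (-((N : ℝ) - 1)) = 2 * ((N : ℝ) - 1) * B / N := by
    rw [eq_div_iff (by positivity), ← hvir]
    ring
  have hB : 0 ≤ B := integral_nonneg fun y => by positivity
  have hX : 0 ≤ X := integral_nonneg fun y => by positivity
  rw [hA0] at h
  change m * (K ^ (1 / (N : ℝ)) / K * (2 * ((N : ℝ) - 1) * B / N)) ≤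
    m ^ (1 / (N : ℝ)) / N * (2 * ((N : ℝ) - 1) / ((N : ℝ) - 2) * (√X * √(m * (K⁻¹ * B)))) at h
  have hexp : 2 / twoStar N = 1 - (1 / (N : ℝ) + 1 / N) := by
    rw [twoStar]
    have : (N : ℝ) - 2 ≠ 0 := by linarith
    field_simp
    ring
  have hmα := Real.rpow_pos_of_pos hm (1 / (N : ℝ))
  have hKα := Real.rpow_pos_of_pos hK (1 / (N : ℝ))
  rw [hexp, Real.rpow_sub hm, Real.rpow_sub hK, Real.rpow_add hm, Real.rpow_add hK, Real.rpow_one,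
    Real.rpow_one]
  set α := m ^ (1 / (N : ℝ))
  set κ := K ^ (1 / (N : ℝ))
  rcases hB.eq_or_lt with hB0 | hB0
  · rw [← hB0]
    simpa using hX
  have hn1 : (0 : ℝ) < (N : ℝ) - 1 := by linarith
  have hn2 : (0 : ℝ) < (N : ℝ) - 2 := by linarith
  have hsq := pow_le_pow_left₀ (by positivity) h 2
  have e : (α / N * (2 * ((N : ℝ) - 1) / ((N : ℝ) - 2) * (√X * √(m * (K⁻¹ * B))))) ^ 2 =
      (α / N * (2 * ((N : ℝ) - 1) / ((N : ℝ) - 2))) ^ 2 * (X * (m * (K⁻¹ * B))) := by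
    rw [← mul_assoc, mul_pow _ (√X * _), mul_pow √X, Real.sq_sqrt hX, Real.sq_sqrt (by positivity)]
  rw [e] at hsq
  set c := (α * (2 * ((N : ℝ) - 1)) / (N * ((N : ℝ) - 2))) ^ 2 * (m * (K⁻¹ * B)) with hc
  have hc0 : 0 < c := by positivity
  refine le_of_mul_le_mul_left ?_ hc0
  calc _ = (m * (κ / K * (2 * ((N : ℝ) - 1) * B / N))) ^ 2 := by
        rw [hc]
        field_simp
    _ ≤ _ := hsq
    _ = _ := by
        rw [hc]
        field_simp

lemma le_sobolevS (hN : 4 ≤ N) {φ : Euc N → ℝ} (hφ : ContDiff ℝ (⊤ : ℕ∞) φ)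
    (hφc : HasCompactSupport φ) (hφ0 : φ ≠ 0) :
    ((N : ℝ) - 2) ^ 2 * bubbleMoment N / bubbleMass N ^ (2 / twoStar N) ≤ sobolevS N := by
  have hN' : (4 : ℝ) ≤ N := by exact_mod_cast hN
  have hp0 : 0 < twoStar N := div_pos (by linarith) (by linarith)
  refine le_csInf ⟨_, φ, hφ, hφc, hφ0, rfl⟩ ?_
  rintro c ⟨v, hv, hvs, hv0, rfl⟩
  obtain ⟨x, hx⟩ := Function.ne_iff.1 hv0
  have hc : Continuous fun x => |v x| ^ twoStar N :=
    hv.continuous.abs.rpow_const fun _ => Or.inr hp0.le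
  have hm : 0 < ∫ x, |v x| ^ twoStar N :=
    integral_pos_of_integrable_nonneg_nonzero (x := x) hc
      (hc.integrable_of_hasCompactSupport (hasCompactSupport_abs_rpow hvs hp0))
      (fun x => by positivity) (Real.rpow_pos_of_pos (abs_pos.2 hx) _).ne'
  rw [le_div_iff₀ (Real.rpow_pos_of_pos hm _)]
  exact mul_rpow_le_integral_norm_gradient_sq hN (hv.of_le (by exact_mod_cast le_top)) hvs hm

end Bubble

/-! ### Asymptotics of the truncated instantons -/

section Instanton

variable {N : ℕ}

/-- The instanton `U_{ε,0}` up to a multiplicative constant. -/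
def bubbleProfile (N : ℕ) (ε : ℝ) (x : Euc N) : ℝ := (ε ^ 2 + ‖x‖ ^ 2) ^ (-(((N : ℝ) - 2) / 2))

lemma instanton_zero_eq {ε : ℝ} (hε : 0 < ε) (x : Euc N) :
    instanton N ε 0 x = ((N : ℝ) * ((N : ℝ) - 2)) ^ (((N : ℝ) - 2) / 4) * ε ^ (((N : ℝ) - 2) / 2) *
      bubbleProfile N ε x := by
  rw [instanton, bubbleProfile, sub_zero, Real.div_rpow hε.le (by positivity),
    Real.rpow_neg (by positivity), div_eq_mul_inv (ε ^ _), mul_assoc]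

lemma continuous_add_norm_sq_rpow {ε : ℝ} (hε : 0 < ε) (s : ℝ) :
    Continuous fun x : Euc N => (ε ^ 2 + ‖x‖ ^ 2) ^ s :=
  Continuous.rpow_const (by fun_prop) fun y => Or.inl (by positivity)

lemma bubbleProfile_pos {ε : ℝ} (hε : 0 < ε) (x : Euc N) : 0 < bubbleProfile N ε x := by
  unfold bubbleProfile
  positivity

lemma bubbleProfile_sq {ε : ℝ} (x : Euc N) :
    bubbleProfile N ε x ^ 2 = (ε ^ 2 + ‖x‖ ^ 2) ^ (-((N : ℝ) - 2)) := by
  rw [bubbleProfile, ← Real.rpow_natCast, ← Real.rpow_mul (by positivity)]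
  congr 1
  push_cast
  ring

lemma bubbleProfile_rpow_twoStar (hN : 4 ≤ N) {ε : ℝ} (x : Euc N) :
    bubbleProfile N ε x ^ twoStar N = (ε ^ 2 + ‖x‖ ^ 2) ^ (-(N : ℝ)) := by
  have hN' : (4 : ℝ) ≤ N := by exact_mod_cast hN
  rw [bubbleProfile, ← Real.rpow_mul (by positivity), twoStar]
  congr 1
  have : (N : ℝ) - 2 ≠ 0 := by linarith
  field_simp

lemma norm_gradient_eq_norm_fderiv (f : Euc N → ℝ) (x : Euc N) :
    ‖gradient f x‖ = ‖fderiv ℝ f x‖ := by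
  rw [gradient, LinearIsometryEquiv.norm_map]

lemma differentiable_bubbleProfile {ε : ℝ} (hε : 0 < ε) :
    Differentiable ℝ (bubbleProfile N ε) := fun x =>
  (hasFDerivAt_add_norm_sq_rpow (by positivity) _ x).differentiableAt

lemma norm_fderiv_bubbleProfile (hN : 4 ≤ N) {ε : ℝ} (hε : 0 < ε) (x : Euc N) :
    ‖fderiv ℝ (bubbleProfile N ε) x‖ =
      ((N : ℝ) - 2) * (‖x‖ * (ε ^ 2 + ‖x‖ ^ 2) ^ (-((N : ℝ) / 2))) := by
  have hN' : (4 : ℝ) ≤ N := by exact_mod_cast hN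
  have h : fderiv ℝ (bubbleProfile N ε) x = _ :=
    (hasFDerivAt_add_norm_sq_rpow (by positivity) _ x).fderiv
  have h0 : 0 ≤ (ε ^ 2 + ‖x‖ ^ 2) ^ (-((N : ℝ) / 2)) := by positivity
  rw [h, show -(((N : ℝ) - 2) / 2) - 1 = -((N : ℝ) / 2) by ring, norm_smul, norm_smul,
    innerSL_apply_norm, norm_mul, Real.norm_of_nonneg h0, norm_neg, Real.norm_of_nonneg,
    Real.norm_of_nonneg]
  · ring
  · norm_num
  · linarith

lemma norm_fderiv_bubbleProfile_sq (hN : 4 ≤ N) {ε : ℝ} (hε : 0 < ε) (x : Euc N) :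
    ‖fderiv ℝ (bubbleProfile N ε) x‖ ^ 2 =
      ((N : ℝ) - 2) ^ 2 * (‖x‖ ^ 2 * (ε ^ 2 + ‖x‖ ^ 2) ^ (-(N : ℝ))) := by
  rw [norm_fderiv_bubbleProfile hN hε, mul_pow, mul_pow, ← Real.rpow_mul_natCast (by positivity)]
  congr 3
  push_cast
  ring

/-- Away from the region where the cut-off equals `1`, the gradient of the truncated profile is
bounded independently of the concentration parameter. -/
lemma exists_norm_gradient_sq_le (hN : 4 ≤ N) {φ : Euc N → ℝ} (hφ : ContDiff ℝ (⊤ : ℕ∞) φ)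
    (hφc : HasCompactSupport φ) {r₀ : ℝ} (hr₀ : 0 < r₀)
    (h1 : ∀ x ∈ Metric.ball (0 : Euc N) r₀, φ x = 1) :
    ∃ C, ∀ ε > 0, ∀ x : Euc N, ‖x‖ ≤ 1 →
      ‖gradient (fun z => φ z * bubbleProfile N ε z) x‖ ^ 2 ≤
        ((N : ℝ) - 2) ^ 2 * (‖x‖ ^ 2 * (ε ^ 2 + ‖x‖ ^ 2) ^ (-(N : ℝ))) + C := by
  have hN' : (4 : ℝ) ≤ N := by exact_mod_cast hN
  obtain ⟨A, hA⟩ := hφc.exists_bound_of_continuous hφ.continuous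
  obtain ⟨B, hB⟩ := (hφc.fderiv ℝ).exists_bound_of_continuous (hφ.continuous_fderiv (by simp))
  have hA0 : 0 ≤ A := (norm_nonneg _).trans (hA 0)
  refine ⟨(A * (((N : ℝ) - 2) * (r₀ ^ 2) ^ (-((N : ℝ) / 2))) +
    (r₀ ^ 2) ^ (-(((N : ℝ) - 2) / 2)) * B) ^ 2, fun ε hε x hx => ?_⟩
  rw [norm_gradient_eq_norm_fderiv]
  rcases lt_or_ge ‖x‖ r₀ with hlt | hge
  · have he : (fun z => φ z * bubbleProfile N ε z) =ᶠ[nhds x] bubbleProfile N ε := by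
      filter_upwards [Metric.isOpen_ball.mem_nhds (mem_ball_zero_iff.2 hlt)] with z hz
      rw [h1 z hz, one_mul]
    rw [he.fderiv_eq, norm_fderiv_bubbleProfile_sq hN hε]
    exact le_add_of_nonneg_right (sq_nonneg _)
  · refine le_add_of_nonneg_of_le (by positivity) (pow_le_pow_left₀ (norm_nonneg _) ?_ 2)
    have hmono : ∀ s : ℝ, 0 ≤ s → (ε ^ 2 + ‖x‖ ^ 2) ^ (-s) ≤ (r₀ ^ 2) ^ (-s) := fun s hs =>
      Real.rpow_le_rpow_of_nonpos (by positivity) (by nlinarith [sq_nonneg ε]) (by linarith)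
    rw [fderiv_fun_mul (hφ.differentiable (by simp) x) (differentiable_bubbleProfile hε x)]
    refine (norm_add_le _ _).trans (add_le_add ?_ ?_)
    · rw [norm_smul, norm_fderiv_bubbleProfile hN hε]
      have hn : (0 : ℝ) ≤ (N : ℝ) - 2 := by linarith
      have hxr : ‖x‖ * (ε ^ 2 + ‖x‖ ^ 2) ^ (-((N : ℝ) / 2)) ≤ (r₀ ^ 2) ^ (-((N : ℝ) / 2)) :=
        (mul_le_of_le_one_left (by positivity) hx).trans (hmono _ (by positivity))
      gcongr
      exact hA x
    · rw [norm_smul, Real.norm_of_nonneg (bubbleProfile_pos hε x).le]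
      exact mul_le_mul (hmono _ (by linarith)) (hB x) (norm_nonneg _) (by positivity)

lemma add_norm_sq_smul_rpow {ε : ℝ} (hε : 0 < ε) (y : Euc N) :
    (ε ^ 2 + ‖ε • y‖ ^ 2) ^ (-(N : ℝ)) =
      (ε ^ N)⁻¹ * (ε ^ N)⁻¹ * (1 + ‖y‖ ^ 2) ^ (-(N : ℝ)) := by
  have e : ε ^ 2 + ‖ε • y‖ ^ 2 = ε ^ 2 * (1 + ‖y‖ ^ 2) := by
    rw [norm_smul, Real.norm_of_nonneg hε.le]
    ring
  rw [e, Real.mul_rpow (by positivity) (by positivity), Real.rpow_neg (by positivity),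
    Real.rpow_natCast, ← mul_inv]
  ring

lemma integrable_add_norm_sq_rpow (hN : 4 ≤ N) {ε : ℝ} (hε : 0 < ε) :
    Integrable fun x : Euc N => (ε ^ 2 + ‖x‖ ^ 2) ^ (-(N : ℝ)) := by
  rw [← integrable_comp_smul_iff volume _ hε.ne']
  simp only [add_norm_sq_smul_rpow hε]
  exact (integrable_bubble hN).const_mul _

lemma integral_add_norm_sq_rpow {ε : ℝ} (hε : 0 < ε) :
    ∫ x : Euc N, (ε ^ 2 + ‖x‖ ^ 2) ^ (-(N : ℝ)) = (ε ^ N)⁻¹ * bubbleMass N := by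
  have h := Measure.integral_comp_smul (volume : Measure (Euc N))
    (fun x : Euc N => (ε ^ 2 + ‖x‖ ^ 2) ^ (-(N : ℝ))) ε
  simp only [add_norm_sq_smul_rpow hε, integral_const_mul, finrank_euclideanSpace,
    Fintype.card_fin] at h
  rw [abs_of_pos (by positivity), smul_eq_mul, mul_assoc] at h
  exact (mul_left_cancel₀ (by positivity) h).symm

lemma norm_sq_mul_add_norm_sq_smul_rpow {ε : ℝ} (hε : 0 < ε) (y : Euc N) :
    ‖ε • y‖ ^ 2 * (ε ^ 2 + ‖ε • y‖ ^ 2) ^ (-(N : ℝ)) =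
      (ε ^ N)⁻¹ * (ε ^ 2 * (ε ^ N)⁻¹) * (‖y‖ ^ 2 * (1 + ‖y‖ ^ 2) ^ (-(N : ℝ))) := by
  rw [add_norm_sq_smul_rpow hε, norm_smul, Real.norm_of_nonneg hε.le]
  ring

lemma integrable_norm_sq_mul_add_norm_sq_rpow (hN : 4 ≤ N) {ε : ℝ} (hε : 0 < ε) :
    Integrable fun x : Euc N => ‖x‖ ^ 2 * (ε ^ 2 + ‖x‖ ^ 2) ^ (-(N : ℝ)) := by
  rw [← integrable_comp_smul_iff volume _ hε.ne']
  simp only [norm_sq_mul_add_norm_sq_smul_rpow hε]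
  exact (integrable_norm_sq_mul_bubble hN).const_mul _

lemma integral_norm_sq_mul_add_norm_sq_rpow {ε : ℝ} (hε : 0 < ε) :
    ∫ x : Euc N, ‖x‖ ^ 2 * (ε ^ 2 + ‖x‖ ^ 2) ^ (-(N : ℝ)) =
      ε ^ 2 * (ε ^ N)⁻¹ * bubbleMoment N := by
  have h := Measure.integral_comp_smul (volume : Measure (Euc N))
    (fun x : Euc N => ‖x‖ ^ 2 * (ε ^ 2 + ‖x‖ ^ 2) ^ (-(N : ℝ))) ε
  simp only [norm_sq_mul_add_norm_sq_smul_rpow hε, integral_const_mul, finrank_euclideanSpace,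
    Fintype.card_fin] at h
  rw [abs_of_pos (by positivity), smul_eq_mul, mul_assoc] at h
  exact (mul_left_cancel₀ (by positivity) h).symm

/-- The gradient term of the truncated profiles. -/
lemma exists_setIntegral_norm_gradient_sq_le (hN : 4 ≤ N) {φ : Euc N → ℝ}
    (hφ : ContDiff ℝ (⊤ : ℕ∞) φ) (hφc : HasCompactSupport φ) {r r₀ : ℝ} (hr : r < 1) (hr₀ : 0 < r₀)
    (h1 : ∀ x ∈ Metric.ball (0 : Euc N) r₀, φ x = 1) :
    ∃ C, ∀ ε > 0, ∫ x in Metric.ball (0 : Euc N) r,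
      ‖gradient (fun z => φ z * bubbleProfile N ε z) x‖ ^ 2 ≤
        ε ^ 2 * (ε ^ N)⁻¹ * (((N : ℝ) - 2) ^ 2 * bubbleMoment N) + C := by
  obtain ⟨C, hC⟩ := exists_norm_gradient_sq_le hN hφ hφc hr₀ h1
  refine ⟨∫ _x in Metric.ball (0 : Euc N) r, C, fun ε hε => ?_⟩
  have hi := (integrable_norm_sq_mul_add_norm_sq_rpow (N := N) hN hε).const_mul (((N : ℝ) - 2) ^ 2)
  have hiC : IntegrableOn (fun _ : Euc N => C) (Metric.ball (0 : Euc N) r) :=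
    integrableOn_const measure_ball_lt_top.ne
  calc _ ≤ ∫ x in Metric.ball (0 : Euc N) r,
        (((N : ℝ) - 2) ^ 2 * (‖x‖ ^ 2 * (ε ^ 2 + ‖x‖ ^ 2) ^ (-(N : ℝ))) + C) := by
        refine integral_mono_of_nonneg (.of_forall fun x => by positivity)
          (hi.integrableOn.add hiC) ?_
        filter_upwards [ae_restrict_mem measurableSet_ball] with x hx
        exact hC ε hε x ((mem_ball_zero_iff.1 hx).le.trans hr.le)
    _ = (∫ x in Metric.ball (0 : Euc N) r,
          ((N : ℝ) - 2) ^ 2 * (‖x‖ ^ 2 * (ε ^ 2 + ‖x‖ ^ 2) ^ (-(N : ℝ)))) + _ :=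
        integral_add hi.integrableOn hiC
    _ ≤ _ := by
        gcongr
        refine (setIntegral_le_integral hi (.of_forall fun x => by positivity)).trans_eq ?_
        rw [integral_const_mul, integral_norm_sq_mul_add_norm_sq_rpow hε]
        ring

/-- The `L^{2*}` term of the truncated profiles. -/
lemma exists_le_setIntegral_rpow_twoStar (hN : 4 ≤ N) {φ : Euc N → ℝ} (hφ : Continuous φ)
    {r r₀ : ℝ} (hr₀ : 0 < r₀) (hr : r₀ ≤ r) (h1 : ∀ x ∈ Metric.ball (0 : Euc N) r₀, φ x = 1) :
    ∃ C ≥ 0, ∀ ε > 0, (ε ^ N)⁻¹ * bubbleMass N - C ≤ ∫ x in Metric.ball (0 : Euc N) r,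
      |φ x * bubbleProfile N ε x| ^ twoStar N := by
  have hN' : (4 : ℝ) ≤ N := by exact_mod_cast hN
  have hp0 : 0 < twoStar N := div_pos (by linarith) (by linarith)
  set a : ℝ := r₀ ^ 2 / (1 + r₀ ^ 2) with ha
  have ha0 : 0 < a := by positivity
  refine ⟨a ^ (-(N : ℝ)) * bubbleMass N, mul_nonneg (by positivity) (bubbleMass_pos hN).le,
    fun ε hε => ?_⟩
  have hi := integrable_add_norm_sq_rpow (N := N) hN hε
  have htail : ∫ x in (Metric.ball (0 : Euc N) r₀)ᶜ, (ε ^ 2 + ‖x‖ ^ 2) ^ (-(N : ℝ)) ≤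
      a ^ (-(N : ℝ)) * bubbleMass N := by
    have hb := (integrable_bubble hN).const_mul (a ^ (-(N : ℝ)))
    calc _ ≤ ∫ x in (Metric.ball (0 : Euc N) r₀)ᶜ,
          a ^ (-(N : ℝ)) * (1 + ‖x‖ ^ 2) ^ (-(N : ℝ)) := by
          refine setIntegral_mono_on hi.integrableOn hb.integrableOn measurableSet_ball.compl
            fun x hx => ?_
          have hx' : r₀ ≤ ‖x‖ := by simpa using hx
          rw [← Real.mul_rpow ha0.le (by positivity)]
          refine Real.rpow_le_rpow_of_nonpos (by positivity) ?_ (by linarith)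
          rw [ha, div_mul_eq_mul_div, div_le_iff₀ (by positivity)]
          nlinarith [pow_le_pow_left₀ hr₀.le hx' 2, mul_nonneg (sq_nonneg ε) (sq_nonneg r₀),
            sq_nonneg ε]
      _ ≤ _ := setIntegral_le_integral hb (.of_forall fun x => by positivity)
      _ = _ := integral_const_mul _ _
  have hsplit := integral_add_compl (measurableSet_ball (x := (0 : Euc N)) (ε := r₀)) hi
  rw [integral_add_norm_sq_rpow hε] at hsplit
  have hcont : Continuous fun x : Euc N => |φ x * bubbleProfile N ε x| ^ twoStar N :=
    (hφ.mul (continuous_add_norm_sq_rpow hε _)).abs.rpow_const fun _ => Or.inr hp0.le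
  calc _ ≤ ∫ x in Metric.ball (0 : Euc N) r₀, (ε ^ 2 + ‖x‖ ^ 2) ^ (-(N : ℝ)) := by linarith
    _ = ∫ x in Metric.ball (0 : Euc N) r₀, |φ x * bubbleProfile N ε x| ^ twoStar N := by
        refine setIntegral_congr_fun measurableSet_ball fun x hx => ?_
        rw [h1 x hx, one_mul, abs_of_pos (bubbleProfile_pos hε x), bubbleProfile_rpow_twoStar hN]
    _ ≤ _ := setIntegral_mono_set
        ((hcont.continuousOn.integrableOn_compact (isCompact_closedBall 0 r)).mono_set
          Metric.ball_subset_closedBall)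
        (.of_forall fun x => by positivity) (Metric.ball_subset_ball hr).eventuallyLE

/-- In dimension at least `4` the limit profile is not square integrable near the origin. -/
lemma not_integrableOn_norm_sq_rpow (hN : 4 ≤ N) {r₀ : ℝ} (hr₀ : 0 < r₀) :
    ¬ IntegrableOn (fun x : Euc N => (‖x‖ ^ 2) ^ (-((N : ℝ) - 2))) (Metric.ball 0 r₀) := by
  have hN' : (4 : ℝ) ≤ N := by exact_mod_cast hN
  have : Nonempty (Fin N) := ⟨⟨0, by omega⟩⟩
  rw [integrableOn_fun_norm_addHaar (μ := volume)
    (f := fun t : ℝ => (t ^ 2) ^ (-((N : ℝ) - 2)))]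
  have h : Set.EqOn (fun y : ℝ => y ^ (Module.finrank ℝ (Euc N) - 1) •
      (y ^ 2) ^ (-((N : ℝ) - 2))) (fun y => y ^ (3 - (N : ℝ))) (Set.Ioo 0 r₀) := fun y hy => by
    simp only [finrank_euclideanSpace, Fintype.card_fin, smul_eq_mul]
    rw [← Real.rpow_natCast, ← Real.rpow_natCast, ← Real.rpow_mul hy.1.le, ← Real.rpow_add hy.1,
      Nat.cast_sub (by omega)]
    congr 1
    push_cast
    ring
  rw [integrableOn_congr_fun h measurableSet_Ioo,
    intervalIntegral.integrableOn_Ioo_rpow_iff hr₀]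
  linarith

/-- The `L²` norm of the profile near the origin blows up as the concentration parameter
tends to `0`. -/
lemma exists_lt_setIntegral_bubbleProfile_sq (hN : 4 ≤ N) {r₀ : ℝ} (hr₀ : 0 < r₀) (M : ℝ) {δ : ℝ}
    (hδ : 0 < δ) : ∃ ε > 0, ε < δ ∧
      M < ∫ x in Metric.ball (0 : Euc N) r₀, bubbleProfile N ε x ^ 2 := by
  by_contra! hM
  refine not_integrableOn_norm_sq_rpow hN hr₀ ?_
  have : NeZero N := ⟨by omega⟩
  let e : ℕ → ℝ := fun n => δ / (n + 2)
  have he0 : ∀ n, 0 < e n := fun n => by positivity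
  have heδ : ∀ n, e n < δ := fun n => div_lt_self hδ (by linarith [n.cast_nonneg (α := ℝ)])
  have het : Filter.Tendsto e Filter.atTop (nhds 0) :=
    tendsto_const_nhds.div_atTop
      (Filter.tendsto_atTop_add_const_right _ _ tendsto_natCast_atTop_atTop)
  have hmeas : ∀ n, Measurable fun x : Euc N => bubbleProfile N (e n) x ^ 2 := fun n =>
    ((continuous_add_norm_sq_rpow (he0 n) _).pow 2).measurable
  have hint : ∀ n, IntegrableOn (fun x : Euc N => bubbleProfile N (e n) x ^ 2)
      (Metric.ball 0 r₀) := fun n =>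
    (((continuous_add_norm_sq_rpow (he0 n) _).pow 2).continuousOn.integrableOn_compact
      (isCompact_closedBall 0 r₀)).mono_set Metric.ball_subset_closedBall
  have hlim : ∀ᵐ x : Euc N ∂volume.restrict (Metric.ball 0 r₀), Filter.Tendsto
      (fun n => ENNReal.ofReal (bubbleProfile N (e n) x ^ 2)) Filter.atTop
      (nhds (ENNReal.ofReal ((‖x‖ ^ 2) ^ (-((N : ℝ) - 2))))) := by
    have : Nonempty (Fin N) := ⟨⟨0, by omega⟩⟩
    filter_upwards [Measure.ae_ne _ (0 : Euc N)] with x hx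
    have hx' : 0 < ‖x‖ := norm_pos_iff.2 hx
    refine (ENNReal.continuous_ofReal.tendsto _).comp ?_
    simp only [bubbleProfile_sq]
    refine Filter.Tendsto.rpow_const ?_ (Or.inl (by positivity))
    simpa using (het.pow 2).add_const (‖x‖ ^ 2)
  refine ⟨(Measurable.pow_const (by fun_prop) _).aestronglyMeasurable, ?_⟩
  rw [hasFiniteIntegral_iff_ofReal (.of_forall fun x => by positivity)]
  calc _ = ∫⁻ x in Metric.ball (0 : Euc N) r₀, Filter.liminf
        (fun n => ENNReal.ofReal (bubbleProfile N (e n) x ^ 2)) Filter.atTop :=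
        lintegral_congr_ae (hlim.mono fun x hx => hx.liminf_eq.symm)
    _ ≤ Filter.liminf (fun n => ∫⁻ x in Metric.ball (0 : Euc N) r₀,
        ENNReal.ofReal (bubbleProfile N (e n) x ^ 2)) Filter.atTop :=
        lintegral_liminf_le fun n => (hmeas n).ennreal_ofReal
    _ ≤ ENNReal.ofReal M := by
        refine Filter.liminf_le_of_frequently_le' (Filter.Frequently.of_forall fun n => ?_)
        rw [← ofReal_integral_eq_lintegral_ofReal (hint n) (.of_forall fun x => by positivity)]
        exact ENNReal.ofReal_le_ofReal (hM _ (he0 n) (heδ n))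
    _ < ⊤ := ENNReal.ofReal_lt_top

lemma mul_setIntegral_sq_le_setIntegral_rho {φ : Euc N → ℝ} (hφ : Continuous φ)
    {r r₀ ε : ℝ} (hε : 0 < ε) (hr : r₀ ≤ r) (hr1 : r < 1)
    (h1 : ∀ x ∈ Metric.ball (0 : Euc N) r₀, φ x = 1) :
    4 * ∫ x in Metric.ball (0 : Euc N) r₀, bubbleProfile N ε x ^ 2 ≤
      ∫ x in Metric.ball (0 : Euc N) r, rho x ^ 2 * (φ x * bubbleProfile N ε x) ^ 2 := by
  have hpos : ∀ x : Euc N, ‖x‖ ≤ r → 0 < 1 - ‖x‖ ^ 2 := fun x hx => by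
    nlinarith [norm_nonneg x]
  have hcψ : Continuous (bubbleProfile N ε) := continuous_add_norm_sq_rpow hε _
  have hi : IntegrableOn (fun x : Euc N => rho x ^ 2 * (φ x * bubbleProfile N ε x) ^ 2)
      (Metric.ball 0 r) := by
    refine (ContinuousOn.integrableOn_compact (isCompact_closedBall (0 : Euc N) r) ?_).mono_set
      Metric.ball_subset_closedBall
    refine ContinuousOn.mul (ContinuousOn.pow ?_ 2) ((hφ.mul hcψ).pow 2).continuousOn
    exact continuousOn_const.div (by fun_prop) fun x hx =>
      (hpos x (mem_closedBall_zero_iff.1 hx)).ne'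
  have hsub := Metric.ball_subset_ball (x := (0 : Euc N)) hr
  rw [← integral_const_mul]
  calc _ ≤ ∫ x in Metric.ball (0 : Euc N) r₀, rho x ^ 2 * (φ x * bubbleProfile N ε x) ^ 2 := by
        refine setIntegral_mono_on ?_ (hi.mono_set hsub) measurableSet_ball fun x hx => ?_
        · exact (((hcψ.pow 2).const_mul 4).continuousOn.integrableOn_compact
            (isCompact_closedBall 0 r₀)).mono_set Metric.ball_subset_closedBall
        · have hx' := hpos x (mem_ball_zero_iff.1 (hsub hx)).le
          have hrho : 2 ≤ rho x := by
            rw [rho, le_div_iff₀ hx']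
            nlinarith [sq_nonneg ‖x‖]
          rw [h1 x hx, one_mul]
          gcongr
          nlinarith
    _ ≤ _ := setIntegral_mono_set hi (.of_forall fun x => by positivity) hsub.eventuallyLE

lemma lt_mul_rpow_of_le (hN : 4 ≤ N) {ε D K C X : ℝ} (hε : 0 < ε) (hε1 : ε < 1) (hD : 0 ≤ D)
    (hK : 0 < K) (hC : 0 ≤ C) (hsmall : ε * ((D + 1) * (C + 1)) < K)
    (hX : (ε ^ N)⁻¹ * K - C ≤ X) :
    0 < X ∧ ε ^ 2 * (ε ^ N)⁻¹ * D - 1 < D / K ^ (2 / twoStar N) * X ^ (2 / twoStar N) := by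
  have hN' : (4 : ℝ) ≤ N := by exact_mod_cast hN
  have hn2 : (N : ℝ) - 2 ≠ 0 := by linarith
  have hs : 2 / twoStar N = 1 - 2 / N := by
    rw [twoStar]
    field_simp
  have hεN : 0 < ε ^ N := by positivity
  have hεN2 : ε ^ N ≤ ε ^ 2 := pow_le_pow_of_le_one hε.le hε1.le (by omega)
  have hε2 : ε ^ 2 ≤ ε := by nlinarith
  have hDC : 0 ≤ D * C := mul_nonneg hD hC
  have hCK : ε ^ N * C < K := by nlinarith
  have hDCK : ε ^ 2 * (D * C) < K := by nlinarith
  set t := ε ^ N * C / K with ht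
  have ht0 : 0 ≤ t := by positivity
  have ht1 : t < 1 := (div_lt_one hK).2 hCK
  have hY : (ε ^ N)⁻¹ * K - C = (ε ^ N)⁻¹ * K * (1 - t) := by
    rw [ht]
    field_simp
  have hY0 : 0 < (ε ^ N)⁻¹ * K * (1 - t) := mul_pos (by positivity) (by linarith)
  rw [hY] at hX
  refine ⟨hY0.trans_le hX, ?_⟩
  have hs0 : 0 ≤ 2 / twoStar N := by
    rw [hs, sub_nonneg, div_le_one (by linarith)]
    linarith
  have hs1 : 2 / twoStar N ≤ 1 := by
    rw [hs]
    linarith [show 0 ≤ 2 / (N : ℝ) by positivity]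
  have hεs : ((ε ^ N)⁻¹) ^ (2 / twoStar N) = ε ^ 2 * (ε ^ N)⁻¹ := by
    rw [Real.inv_rpow hεN.le, hs, Real.rpow_sub hεN, Real.rpow_one, ← Real.rpow_natCast_mul hε.le,
      mul_div_cancel₀ _ (by positivity : (N : ℝ) ≠ 0), Real.rpow_two, inv_div, div_eq_mul_inv]
  have hKs : 0 < K ^ (2 / twoStar N) := Real.rpow_pos_of_pos hK _
  calc ε ^ 2 * (ε ^ N)⁻¹ * D - 1 < ε ^ 2 * (ε ^ N)⁻¹ * D * (1 - t) := by
        have : ε ^ 2 * (ε ^ N)⁻¹ * D * t = ε ^ 2 * (D * C) / K := by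
          rw [ht]
          field_simp
        have h1 : ε ^ 2 * (D * C) / K < 1 := (div_lt_one hK).2 hDCK
        linarith
    _ ≤ ε ^ 2 * (ε ^ N)⁻¹ * D * (1 - t) ^ (2 / twoStar N) := by
        gcongr
        exact Real.self_le_rpow_of_le_one (by linarith) (by linarith) hs1
    _ = D / K ^ (2 / twoStar N) * ((ε ^ N)⁻¹ * K * (1 - t)) ^ (2 / twoStar N) := by
        rw [Real.mul_rpow (by positivity) (by linarith), Real.mul_rpow (by positivity) hK.le, hεs]
        field_simp
    _ ≤ _ := by gcongr

/-- The quotient is unchanged when the instanton is replaced by the unnormalized profile. -/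
lemma quotient_instanton_eq (hN : 4 ≤ N) {φ : Euc N → ℝ} (hφ : ContDiff ℝ (⊤ : ℕ∞) φ) {ε : ℝ}
    (hε : 0 < ε) (Λ : ℝ) (s : Set (Euc N)) :
    ((∫ x in s, ‖gradient (fun z => φ z * instanton N ε 0 z) x‖ ^ 2) -
        Λ * ∫ x in s, rho x ^ 2 * (φ x * instanton N ε 0 x) ^ 2) /
      (∫ x in s, |φ x * instanton N ε 0 x| ^ twoStar N) ^ (2 / twoStar N) =
    ((∫ x in s, ‖gradient (fun z => φ z * bubbleProfile N ε z) x‖ ^ 2) -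
        Λ * ∫ x in s, rho x ^ 2 * (φ x * bubbleProfile N ε x) ^ 2) /
      (∫ x in s, |φ x * bubbleProfile N ε x| ^ twoStar N) ^ (2 / twoStar N) := by
  have hN' : (4 : ℝ) ≤ N := by exact_mod_cast hN
  have hp0 : 0 < twoStar N := div_pos (by linarith) (by linarith)
  have hn2 : 0 < (N : ℝ) - 2 := by linarith
  obtain ⟨k, hk0, hk⟩ : ∃ k > 0, ∀ x : Euc N, instanton N ε 0 x = k * bubbleProfile N ε x :=
    ⟨_, by positivity, instanton_zero_eq hε⟩
  have hmul : ∀ x : Euc N, φ x * (k * bubbleProfile N ε x) = k * (φ x * bubbleProfile N ε x) :=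
    fun x => by ring
  have hgrad : ∀ x : Euc N, ‖gradient (fun z => k * (φ z * bubbleProfile N ε z)) x‖ ^ 2 =
      k ^ 2 * ‖gradient (fun z => φ z * bubbleProfile N ε z) x‖ ^ 2 := fun x => by
    rw [norm_gradient_eq_norm_fderiv, norm_gradient_eq_norm_fderiv, fderiv_const_mul
      ((hφ.differentiable (by simp) x).fun_mul (differentiable_bubbleProfile hε x)), norm_smul,
      mul_pow, Real.norm_of_nonneg hk0.le]
  have hrho : ∀ x : Euc N, rho x ^ 2 * (k * (φ x * bubbleProfile N ε x)) ^ 2 =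
      k ^ 2 * (rho x ^ 2 * (φ x * bubbleProfile N ε x) ^ 2) := fun x => by ring
  have habs : ∀ x : Euc N, |k * (φ x * bubbleProfile N ε x)| ^ twoStar N =
      k ^ twoStar N * |φ x * bubbleProfile N ε x| ^ twoStar N := fun x => by
    rw [abs_mul, abs_of_pos hk0, Real.mul_rpow hk0.le (abs_nonneg _)]
  have hk2 : (k ^ twoStar N) ^ (2 / twoStar N) = k ^ 2 := by
    rw [← Real.rpow_mul hk0.le, mul_div_cancel₀ _ hp0.ne', Real.rpow_two]
  simp only [hk, hmul, hgrad, hrho, habs, integral_const_mul]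
  rw [Real.mul_rpow (by positivity) (integral_nonneg fun x => by positivity), hk2,
    mul_left_comm Λ, ← mul_sub, mul_div_mul_left _ _ (by positivity)]

end Instanton

/-- For a localized Aubin–Talenti bubble, the Rayleigh quotient drops
strictly below the Sobolev constant `S` for some small `ε > 0`. -/
theorem stmt_8 {N : ℕ} (hN : 4 ≤ N) (lam : ℝ) (hlam : lam0 N < lam)
    (r : ℝ) (hr0 : 0 < r) (hr1 : r < 1) (φ : Euc N → ℝ)
    (hφ : ContDiff ℝ (⊤ : ℕ∞) φ) (hφc : HasCompactSupport φ)
    (hφs : tsupport φ ⊆ Metric.ball (0 : Euc N) r)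
    (hφrad : ∀ x y : Euc N, ‖x‖ = ‖y‖ → φ x = φ y)
    (hφ1 : ∀ᶠ x in nhds (0 : Euc N), φ x = 1) :
    ∃ ε > 0,
      ((∫ x in Metric.ball (0 : Euc N) r,
            ‖gradient (fun z => φ z * instanton N ε 0 z) x‖ ^ 2)
          - (lam - lam0 N) *
              ∫ x in Metric.ball (0 : Euc N) r, rho x ^ 2 * (φ x * instanton N ε 0 x) ^ 2) /
        (∫ x in Metric.ball (0 : Euc N) r,
            |φ x * instanton N ε 0 x| ^ twoStar N) ^ (2 / twoStar N)
        < sobolevS N := by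
  have hK := bubbleMass_pos hN
  have hB : 0 ≤ bubbleMoment N := integral_nonneg fun y => by positivity
  have hφ0 : φ ≠ 0 := fun h => by simpa [h] using hφ1.self_of_nhds
  obtain ⟨r₁, hr₁, h1⟩ := Metric.eventually_nhds_iff_ball.1 hφ1
  set r₀ := min r₁ r
  have hr₀ : 0 < r₀ := lt_min hr₁ hr0
  have hr₀r : r₀ ≤ r := min_le_right _ _
  have h1' : ∀ x ∈ Metric.ball (0 : Euc N) r₀, φ x = 1 := fun x hx =>
    h1 x (Metric.ball_subset_ball (min_le_left _ _) hx)
  obtain ⟨C₁, hC₁⟩ := exists_setIntegral_norm_gradient_sq_le hN hφ hφc hr1 hr₀ h1'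
  obtain ⟨C₂, hC₂0, hC₂⟩ := exists_le_setIntegral_rpow_twoStar hN hφ.continuous hr₀ hr₀r h1'
  set D := ((N : ℝ) - 2) ^ 2 * bubbleMoment N
  have hD : 0 ≤ D := by positivity
  have hΛ : 0 < lam - lam0 N := sub_pos.2 hlam
  have hDC : 0 < (D + 1) * (C₂ + 1) := by positivity
  obtain ⟨ε, hε, hεδ, hM⟩ := exists_lt_setIntegral_bubbleProfile_sq hN hr₀
    ((C₁ + 1) / ((lam - lam0 N) * 4)) (lt_min one_pos (div_pos hK hDC))
  refine ⟨ε, hε, ?_⟩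
  rw [quotient_instanton_eq hN hφ hε]
  obtain ⟨hX0, hX⟩ := lt_mul_rpow_of_le hN hε (hεδ.trans_le (min_le_left _ _)) hD hK hC₂0
    ((lt_div_iff₀ hDC).1 (hεδ.trans_le (min_le_right _ _))) (hC₂ ε hε)
  refine lt_of_lt_of_le ?_ (le_sobolevS hN hφ hφc hφ0)
  rw [div_lt_iff₀ (Real.rpow_pos_of_pos hX0 _)]
  refine lt_of_le_of_lt ?_ hX
  have hrho := mul_le_mul_of_nonneg_left
    (mul_setIntegral_sq_le_setIntegral_rho hφ.continuous hε hr₀r hr1 h1') hΛ.le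
  rw [div_lt_iff₀ (by positivity)] at hM
  linarith [hC₁ ε hε]
end
end

section
/- Let N ≥ 3, let Ω ⊆ B be a bounded open set, and let λ₀ < λ₁ be real numbers such that the Poincaré-type inequality ∫_Ω |∇ψ|² dx ≥ (λ₁ − λ₀) ∫_Ω ϱ² ψ² dx holds for every smooth ψ with compact support in Ω. Let λ > λ₀ and let v, w be smooth real-valued functions with compact support contained in Ω satisfying ∫_Ω |∇w|² dx = (λ − λ₀) ∫_Ω ϱ² v w dx. Then ( ∫_Ω |∇w|² dx )^{1/2} ≤ ((λ − λ₀)/(λ₁ − λ₀)) ( ∫_Ω |∇v|² dx )^{1/2}. -/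
open MeasureTheory Real RealInnerProductSpace

noncomputable section

lemma integrable_rho_sq_mul_mul {N : ℕ} {f g : Euc N → ℝ} (hf : Continuous f)
    (hfc : HasCompactSupport f) (hfs : tsupport f ⊆ {x : Euc N | ‖x‖ < 1})
    (hg : Continuous g) : Integrable fun x => rho x ^ 2 * f x * g x := by
  have hc : Continuous fun x => rho x ^ 2 * f x := by
    refine continuous_of_tsupport fun x hx => ?_
    have hx1 : ‖x‖ < 1 := hfs (tsupport_mul_subset_right hx)
    have hne : 1 - ‖x‖ ^ 2 ≠ 0 := by nlinarith [norm_nonneg x]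
    have hrho : ContinuousAt (rho : Euc N → ℝ) x :=
      continuousAt_const.div (by fun_prop) hne
    exact (hrho.pow 2).mul hf.continuousAt
  have hcs : HasCompactSupport fun x => rho x ^ 2 * f x := hfc.mul_left
  exact (hc.mul hg).integrable_of_hasCompactSupport hcs.mul_right

lemma sq_integral_rho_sq_mul_mul_le {N : ℕ} {Ω : Set (Euc N)} {v w : Euc N → ℝ}
    (hv : Continuous v) (hvc : HasCompactSupport v) (hvs : tsupport v ⊆ {x : Euc N | ‖x‖ < 1})
    (hw : Continuous w) (hwc : HasCompactSupport w) (hws : tsupport w ⊆ {x : Euc N | ‖x‖ < 1}) :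
    (∫ x in Ω, rho x ^ 2 * v x * w x) ^ 2
      ≤ (∫ x in Ω, rho x ^ 2 * v x ^ 2) * ∫ x in Ω, rho x ^ 2 * w x ^ 2 := by
  have hvw := (integrable_rho_sq_mul_mul hv hvc hvs hw).integrableOn (s := Ω)
  have hvv : IntegrableOn (fun x => rho x ^ 2 * v x ^ 2) Ω := by
    simpa only [mul_assoc, ← pow_two] using
      (integrable_rho_sq_mul_mul hv hvc hvs hv).integrableOn (s := Ω)
  have hww : IntegrableOn (fun x => rho x ^ 2 * w x ^ 2) Ω := by
    simpa only [mul_assoc, ← pow_two] using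
      (integrable_rho_sq_mul_mul hw hwc hws hw).integrableOn (s := Ω)
  have hquad : ∀ t : ℝ, 0 ≤ (∫ x in Ω, rho x ^ 2 * w x ^ 2) * (t * t)
      + (2 * ∫ x in Ω, rho x ^ 2 * v x * w x) * t + ∫ x in Ω, rho x ^ 2 * v x ^ 2 := by
    intro t
    have hsum : IntegrableOn (fun x => rho x ^ 2 * w x ^ 2 * (t * t)
        + rho x ^ 2 * v x * w x * (2 * t)) Ω := (hww.mul_const _).add (hvw.mul_const _)
    have hexp : (∫ x in Ω, rho x ^ 2 * (v x + t * w x) ^ 2)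
        = (∫ x in Ω, rho x ^ 2 * w x ^ 2) * (t * t)
          + (∫ x in Ω, rho x ^ 2 * v x * w x) * (2 * t) + ∫ x in Ω, rho x ^ 2 * v x ^ 2 := by
      rw [← integral_mul_const, ← integral_mul_const,
        ← integral_add (hww.mul_const _) (hvw.mul_const _),
        ← integral_add hsum hvv]
      congr 1 with x
      ring
    have hpos : 0 ≤ ∫ x in Ω, rho x ^ 2 * (v x + t * w x) ^ 2 :=
      integral_nonneg fun x => by positivity
    linarith
  have hdisc := discrim_le_zero hquad
  rw [discrim] at hdisc
  linarith

/-- Contraction property of the solution operator `K₀`: if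
`∫ |∇w|² = (λ−λ₀) ∫ ϱ² v w` (the weak equation tested against `w`), then
`‖w‖ ≤ ((λ−λ₀)/(λ₁−λ₀)) ‖v‖` in the Dirichlet norm. -/
theorem stmt_12 {N : ℕ} (hN : 3 ≤ N) (Ω : Set (Euc N)) (hΩ : IsOpen Ω)
    (hΩb : Bornology.IsBounded Ω) (hΩB : Ω ⊆ {x : Euc N | ‖x‖ < 1})
    (lam1 : ℝ) (hl1 : lam0 N < lam1)
    (hPoincare : ∀ ψ : Euc N → ℝ, ContDiff ℝ (⊤ : ℕ∞) ψ → HasCompactSupport ψ →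
      tsupport ψ ⊆ Ω →
      (lam1 - lam0 N) * (∫ x in Ω, rho x ^ 2 * ψ x ^ 2) ≤ ∫ x in Ω, ‖gradient ψ x‖ ^ 2)
    (lam : ℝ) (hlam : lam0 N < lam)
    (v w : Euc N → ℝ)
    (hv : ContDiff ℝ (⊤ : ℕ∞) v) (hvc : HasCompactSupport v) (hvs : tsupport v ⊆ Ω)
    (hw : ContDiff ℝ (⊤ : ℕ∞) w) (hwc : HasCompactSupport w) (hws : tsupport w ⊆ Ω)
    (heq : (∫ x in Ω, ‖gradient w x‖ ^ 2)
        = (lam - lam0 N) * ∫ x in Ω, rho x ^ 2 * v x * w x) :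
    Real.sqrt (∫ x in Ω, ‖gradient w x‖ ^ 2)
      ≤ ((lam - lam0 N) / (lam1 - lam0 N)) *
          Real.sqrt (∫ x in Ω, ‖gradient v x‖ ^ 2) := by
  have hCS := sq_integral_rho_sq_mul_mul_le (Ω := Ω) hv.continuous hvc (hvs.trans hΩB)
    hw.continuous hwc (hws.trans hΩB)
  have hPv := hPoincare v hv hvc hvs
  have hPw := hPoincare w hw hwc hws
  have hC : 0 ≤ ∫ x in Ω, rho x ^ 2 * w x ^ 2 := integral_nonneg fun x => by positivity
  have hV : 0 ≤ ∫ x in Ω, ‖gradient v x‖ ^ 2 := integral_nonneg fun x => by positivity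
  have hW : 0 ≤ ∫ x in Ω, ‖gradient w x‖ ^ 2 := integral_nonneg fun x => by positivity
  generalize (∫ x in Ω, ‖gradient w x‖ ^ 2) = W at *
  generalize (∫ x in Ω, ‖gradient v x‖ ^ 2) = V at *
  generalize (∫ x in Ω, rho x ^ 2 * v x * w x) = D at *
  generalize (∫ x in Ω, rho x ^ 2 * v x ^ 2) = A at *
  generalize (∫ x in Ω, rho x ^ 2 * w x ^ 2) = C at *
  have ha : 0 < lam - lam0 N := sub_pos.2 hlam
  have hb : 0 < lam1 - lam0 N := sub_pos.2 hl1
  generalize lam - lam0 N = a at *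
  generalize lam1 - lam0 N = b at *
  have hkey : (b ^ 2 * W) * W ≤ (a ^ 2 * V) * W :=
    calc (b ^ 2 * W) * W = b ^ 2 * a ^ 2 * D ^ 2 := by rw [heq]; ring
      _ ≤ b ^ 2 * a ^ 2 * (A * C) := by gcongr
      _ = a ^ 2 * ((b * A) * (b * C)) := by ring
      _ ≤ a ^ 2 * (V * W) := by gcongr
      _ = (a ^ 2 * V) * W := by ring
  have hle : W ≤ (a / b) ^ 2 * V := by
    rcases hW.eq_or_lt with h | h
    · rw [← h]
      positivity
    · rw [div_pow, div_mul_eq_mul_div, le_div_iff₀ (by positivity), mul_comm W]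
      exact le_of_mul_le_mul_right hkey h
  calc √W ≤ √((a / b) ^ 2 * V) := Real.sqrt_le_sqrt hle
    _ = a / b * √V := by rw [Real.sqrt_mul (by positivity), Real.sqrt_sq (by positivity)]
end
end

section
/- Let H be a real Hilbert space, let I : H → ℝ be differentiable with gradient ∇I, let δ > 0, ε > 0, t₁ > 0, and let φ : [0, t₁] → H be differentiable with φ′(t) = −∇I(φ(t)) for all t ∈ [0, t₁], where s ↦ ∇I(φ(s)) is continuous on [0, t₁]. If ‖φ(t₁) − φ(0)‖ ≥ δ and ‖∇I(φ(s))‖ ≥ 2ε/δ for all s ∈ [0, t₁], then I(φ(0)) − I(φ(t₁)) ≥ 2ε. (A gradient-flow trajectory that travels distance at least δ through a region where the gradient is at least 2ε/δ in norm must dissipate energy at least 2ε.) -/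
/-- The energy `I` decreases along its negative gradient flow at the rate `‖∇I‖ ^ 2`. -/
theorem hasDerivAt_comp_neg_gradient_flow {H : Type*} [NormedAddCommGroup H]
    [InnerProductSpace ℝ H] [CompleteSpace H] {I : H → ℝ} {φ : ℝ → H} {t : ℝ}
    (hI : DifferentiableAt ℝ I (φ t)) (hφ : HasDerivAt φ (-gradient I (φ t)) t) :
    HasDerivAt (fun s => I (φ s)) (-‖gradient I (φ t)‖ ^ 2) t := by
  have h := hI.hasGradientAt.hasFDerivAt.comp_hasDerivAt t hφ
  rwa [InnerProductSpace.toDual_apply_apply, inner_neg_right, real_inner_self_eq_norm_sq] at h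

/-- Along a negative gradient-flow trajectory on which `‖∇I‖ ≥ c`, the energy drop is at least
`c` times the distance travelled. -/
theorem norm_sub_le_energy_drop_div {H : Type*} [NormedAddCommGroup H]
    [InnerProductSpace ℝ H] [CompleteSpace H] {I : H → ℝ} (hI : Differentiable ℝ I)
    {φ : ℝ → H} {a b c : ℝ} (hc : 0 < c) (hab : a ≤ b)
    (hφ : ∀ t ∈ Set.Icc a b, HasDerivAt φ (-gradient I (φ t)) t)
    (hgrad : ∀ t ∈ Set.Icc a b, c ≤ ‖gradient I (φ t)‖) :
    ‖φ b - φ a‖ ≤ (I (φ a) - I (φ b)) / c := by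
  have hf : ∀ t ∈ Set.Icc a b, HasDerivAt (fun s => φ s - φ a) (-gradient I (φ t)) t :=
    fun t ht => (hφ t ht).sub_const _
  have hB : ∀ t ∈ Set.Icc a b,
      HasDerivAt (fun s => (I (φ a) - I (φ s)) / c) (‖gradient I (φ t)‖ ^ 2 / c) t := by
    intro t ht
    simpa using
      ((hasDerivAt_comp_neg_gradient_flow (hI _) (hφ t ht)).const_sub (I (φ a))).div_const c
  refine image_norm_le_of_norm_deriv_right_le_deriv_boundary'
    (fun t ht => (hf t ht).continuousAt.continuousWithinAt)
    (fun t ht => (hf t (Set.Ico_subset_Icc_self ht)).hasDerivWithinAt) (by simp)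
    (fun t ht => (hB t ht).continuousAt.continuousWithinAt)
    (fun t ht => (hB t (Set.Ico_subset_Icc_self ht)).hasDerivWithinAt)
    (fun t ht => ?_) (Set.right_mem_Icc.2 hab)
  have := hgrad t (Set.Ico_subset_Icc_self ht)
  rw [norm_neg, le_div_iff₀ hc, sq]
  gcongr

/-- A negative gradient-flow trajectory that travels distance at least `δ`
through a region where `‖∇I‖ ≥ 2ε/δ` dissipates energy at least `2ε`. -/
theorem stmt_16 {H : Type*} [NormedAddCommGroup H] [InnerProductSpace ℝ H]
    [CompleteSpace H] (I : H → ℝ) (hI : Differentiable ℝ I) (δ ε t₁ : ℝ)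
    (hδ : 0 < δ) (hε : 0 < ε) (ht₁ : 0 < t₁) (φ : ℝ → H)
    (hφ : ∀ t ∈ Set.Icc 0 t₁, HasDerivAt φ (-gradient I (φ t)) t)
    (hcont : ContinuousOn (fun s => gradient I (φ s)) (Set.Icc 0 t₁))
    (hdist : δ ≤ ‖φ t₁ - φ 0‖)
    (hgrad : ∀ s ∈ Set.Icc 0 t₁, 2 * ε / δ ≤ ‖gradient I (φ s)‖) :
    2 * ε ≤ I (φ 0) - I (φ t₁) := by
  have hc : 0 < 2 * ε / δ := by positivity
  have h := hdist.trans (norm_sub_le_energy_drop_div hI hc ht₁.le hφ hgrad)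
  rwa [le_div_iff₀ hc, mul_div_cancel₀ _ hδ.ne'] at h
end

section
/- Let X be a real normed vector space, let D ⊆ X be a closed convex set, let K : X → X be continuous, let T > 0, and let φ : [0, T] → X be differentiable with φ′(t) = −φ(t) + K(φ(t)) for all t ∈ [0, T]. Assume K(d) belongs to the interior of D for every d ∈ D, and that φ(t) ∈ D for every t ∈ [0, T]. Then φ(t) belongs to the interior of D for every t ∈ (0, T]. (Strict positive invariance of D under the semilinear flow.) -/
/-- If `φ` runs in the convex set `D` just before time `t` and its velocity at `t`, drawn from
`φ t`, points to an interior point of `D`, then `φ t` is an interior point of `D`. -/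
theorem Convex.mem_interior_of_hasDerivWithinAt {X : Type*} [NormedAddCommGroup X]
    [NormedSpace ℝ X] {D : Set X} (hD : Convex ℝ D) {φ : ℝ → X} {v : X} {t : ℝ}
    (hφ : HasDerivWithinAt φ v (Set.Iio t) t) (hv : φ t + v ∈ interior D)
    (hφD : ∀ᶠ s in nhdsWithin t (Set.Iio t), φ s ∈ D) : φ t ∈ interior D := by
  have hslope : Filter.Tendsto (fun s => φ t + slope φ t s) (nhdsWithin t (Set.Iio t))
      (nhds (φ t + v)) :=
    ((hasDerivWithinAt_iff_tendsto_slope' (by simp)).1 hφ).const_add _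
  obtain ⟨s, ⟨hs, hsD⟩, hst : s < t⟩ :=
    (((hslope.eventually (isOpen_interior.mem_nhds hv)).and hφD).and
      self_mem_nhdsWithin).exists
  have hpos : 0 < 1 + (t - s) := by linarith
  have hne : s - t ≠ 0 := by linarith
  have hcombo := hD.combo_self_interior_mem_interior hsD hs
    (a := 1 / (1 + (t - s))) (b := (t - s) / (1 + (t - s)))
    (by positivity) (div_pos (by linarith) hpos) (by field_simp)
  convert hcombo using 1
  rw [slope_def_module]
  match_scalars <;> field_simp <;> ring

/-- Strict positive invariance: if `K` maps the closed convex set `D` into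
its interior and the trajectory of `φ′ = −φ + K(φ)` stays in `D`, then for positive times the
trajectory lies in the interior of `D`. -/
theorem stmt_17 {X : Type*} [NormedAddCommGroup X] [NormedSpace ℝ X]
    (D : Set X) (hDclosed : IsClosed D) (hDconv : Convex ℝ D)
    (K : X → X) (hK : Continuous K) (hKD : ∀ d ∈ D, K d ∈ interior D)
    (T : ℝ) (hT : 0 < T) (φ : ℝ → X)
    (hφ : ∀ t ∈ Set.Icc 0 T, HasDerivAt φ (-φ t + K (φ t)) t)
    (hφD : ∀ t ∈ Set.Icc 0 T, φ t ∈ D) :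
    ∀ t ∈ Set.Ioc 0 T, φ t ∈ interior D := by
  intro t ht
  have htT : t ∈ Set.Icc 0 T := Set.Ioc_subset_Icc_self ht
  refine hDconv.mem_interior_of_hasDerivWithinAt (hφ t htT).hasDerivWithinAt ?_ ?_
  · simpa using hKD _ (hφD t htT)
  · filter_upwards [Ioo_mem_nhdsLT ht.1] with s hs
    exact hφD s ⟨hs.1.le, hs.2.le.trans ht.2⟩
end
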